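/- arXiv:2605.05041 — 6 statements merged into one kernel-verified Lean document; each statement's English description precedes it below -/
import Mathlib

section
/- Let n ≥ 2, let Ω ⊆ ℝ^n be open, let u : Ω → ℝ be continuously differentiable on Ω, and let K ⊆ {x ∈ Ω : u(x) = 0} be relatively closed in Ω. If u is harmonic on Ω \ K, then u is harmonic on all of Ω. -/
open Set Metric

/-- The Laplacian of `f : ℝⁿ → ℝ`, as the sum of the pure second partial derivatives
`∑ i, ∂²f/∂xᵢ²`. -/
noncomputable def eLaplacian {n : ℕ} (f : EuclideanSpace ℝ (Fin n) → ℝ)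
    (x : EuclideanSpace ℝ (Fin n)) : ℝ :=
  ∑ i : Fin n,
    iteratedFDeriv ℝ 2 f x ![EuclideanSpace.single i (1 : ℝ), EuclideanSpace.single i (1 : ℝ)]

/-- `f` is harmonic on `U`: it is twice continuously differentiable on `U` and its Laplacian
vanishes identically on `U`. -/
def HarmonicOnE {n : ℕ} (f : EuclideanSpace ℝ (Fin n) → ℝ)
    (U : Set (EuclideanSpace ℝ (Fin n))) : Prop :=
  ContDiffOn ℝ 2 f U ∧ ∀ x ∈ U, eLaplacian f x = 0

open MeasureTheory Filter Topology
open scoped ContDiff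

section DirectionalDerivative

variable {n : ℕ}

/-- The derivative of `f` in the direction `v`. -/
noncomputable def dirDeriv (v : EuclideanSpace ℝ (Fin n)) (f : EuclideanSpace ℝ (Fin n) → ℝ) :
    EuclideanSpace ℝ (Fin n) → ℝ :=
  fun x => fderiv ℝ f x v

/-- The partial derivative `∂f/∂xᵢ`. -/
noncomputable abbrev partialDeriv (i : Fin n) (f : EuclideanSpace ℝ (Fin n) → ℝ) :
    EuclideanSpace ℝ (Fin n) → ℝ :=
  dirDeriv (EuclideanSpace.single i (1 : ℝ)) f

/-- `∫ ∇u ⬝ ∇φ = 0` for every test function `φ` supported in `U`. -/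
def WeaklyHarmonicOn (u : EuclideanSpace ℝ (Fin n) → ℝ) (U : Set (EuclideanSpace ℝ (Fin n))) :
    Prop :=
  ∀ φ : EuclideanSpace ℝ (Fin n) → ℝ, ContDiff ℝ ∞ φ → HasCompactSupport φ → tsupport φ ⊆ U →
    ∫ x, ∑ i, partialDeriv i u x * partialDeriv i φ x = 0

variable {f g : EuclideanSpace ℝ (Fin n) → ℝ} {U : Set (EuclideanSpace ℝ (Fin n))}
  {v w x : EuclideanSpace ℝ (Fin n)}

protected theorem ContDiffOn.dirDeriv {k m : ℕ∞ω} (hf : ContDiffOn ℝ k f U) (hU : IsOpen U)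
    (hm : m + 1 ≤ k) (v : EuclideanSpace ℝ (Fin n)) : ContDiffOn ℝ m (dirDeriv v f) U :=
  (hf.fderiv_of_isOpen hU hm).clm_apply contDiffOn_const

theorem ContDiffOn.continuousOn_dirDeriv (hf : ContDiffOn ℝ 1 f U) (hU : IsOpen U)
    (v : EuclideanSpace ℝ (Fin n)) : ContinuousOn (dirDeriv v f) U :=
  (hf.dirDeriv (m := 0) hU (by simp) v).continuousOn

protected theorem ContDiff.dirDeriv (hf : ContDiff ℝ ∞ f) (v : EuclideanSpace ℝ (Fin n)) :
    ContDiff ℝ ∞ (dirDeriv v f) :=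
  (hf.fderiv_right (m := ∞) (by simp)).clm_apply contDiff_const

theorem tsupport_dirDeriv_subset (f : EuclideanSpace ℝ (Fin n) → ℝ)
    (v : EuclideanSpace ℝ (Fin n)) : tsupport (dirDeriv v f) ⊆ tsupport f :=
  tsupport_fderiv_apply_subset ℝ v

protected theorem HasCompactSupport.dirDeriv (hf : HasCompactSupport f)
    (v : EuclideanSpace ℝ (Fin n)) : HasCompactSupport (dirDeriv v f) :=
  hf.fderiv_apply ℝ v

theorem dirDeriv_mul (hf : DifferentiableAt ℝ f x) (hg : DifferentiableAt ℝ g x) :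
    dirDeriv v (fun y => f y * g y) x = dirDeriv v f x * g x + f x * dirDeriv v g x := by
  simp only [dirDeriv]
  rw [fderiv_fun_mul hf hg]
  simp
  ring

theorem dirDeriv_comp {b : ℝ → ℝ} {b' : ℝ} (hb : HasDerivAt b b' (f x))
    (hf : DifferentiableAt ℝ f x) :
    dirDeriv v (fun y => b (f y)) x = b' * dirDeriv v f x := by
  simp only [dirDeriv]
  rw [HasFDerivAt.fderiv (f := fun y => b (f y)) (hb.comp_hasFDerivAt x hf.hasFDerivAt)]
  simp

theorem dirDeriv_congr (h : f =ᶠ[𝓝 x] g) : dirDeriv v f x = dirDeriv v g x := by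
  simp only [dirDeriv, h.fderiv_eq]

theorem dirDeriv_eq_zero (h : f =ᶠ[𝓝 x] fun _ => 0) : dirDeriv v f x = 0 := by
  rw [dirDeriv_congr h]
  simp [dirDeriv]

theorem dirDeriv_comm (hf : ContDiffAt ℝ 2 f x) :
    dirDeriv v (dirDeriv w f) x = dirDeriv w (dirDeriv v f) x := by
  have hd : DifferentiableAt ℝ (fderiv ℝ f) x :=
    (hf.fderiv_right (m := 1) (by norm_num)).differentiableAt (by simp)
  have h : ∀ a b : EuclideanSpace ℝ (Fin n),
      dirDeriv a (dirDeriv b f) x = fderiv ℝ (fderiv ℝ f) x a b := by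
    intro a b
    change fderiv ℝ (fun y => fderiv ℝ f y b) x a = _
    rw [fderiv_clm_apply hd (by fun_prop)]
    simp
  rw [h, h]
  exact hf.isSymmSndFDerivAt (by simp) v w

theorem eLaplacian_eq_sum_partialDeriv (hf : ContDiffAt ℝ 2 f x) :
    eLaplacian f x = ∑ i, partialDeriv i (partialDeriv i f) x := by
  have hd : DifferentiableAt ℝ (fderiv ℝ f) x :=
    (hf.fderiv_right (m := 1) (by norm_num)).differentiableAt (by simp)
  refine Finset.sum_congr rfl fun i _ => ?_
  rw [iteratedFDeriv_two_apply]
  change _ = fderiv ℝ (fun y => fderiv ℝ f y (EuclideanSpace.single i 1)) x _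
  rw [fderiv_clm_apply hd (by fun_prop)]
  simp

end DirectionalDerivative

section IntegrationByParts

variable {n : ℕ} {U : Set (EuclideanSpace ℝ (Fin n))}

theorem integrable_mul_of_tsupport_subset {f φ : EuclideanSpace ℝ (Fin n) → ℝ} (hU : IsOpen U)
    (hf : ContinuousOn f U) (hφ : ContinuousOn φ U) (hc : HasCompactSupport φ)
    (hs : tsupport φ ⊆ U) : Integrable (fun x => f x * φ x) := by
  refine Continuous.integrable_of_hasCompactSupport ?_ hc.mul_left
  refine continuous_of_tsupport fun x hx => ?_
  have hx' : x ∈ U := hs (closure_mono (Function.support_mul_subset_right f φ) hx)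
  exact (hf.continuousAt (hU.mem_nhds hx')).mul (hφ.continuousAt (hU.mem_nhds hx'))

theorem integral_mul_dirDeriv {f φ : EuclideanSpace ℝ (Fin n) → ℝ} (hU : IsOpen U)
    (hf : ContDiffOn ℝ 1 f U) (hφ : ContDiff ℝ ∞ φ) (hc : HasCompactSupport φ)
    (hs : tsupport φ ⊆ U) (v : EuclideanSpace ℝ (Fin n)) :
    ∫ x, f x * dirDeriv v φ x = -∫ x, dirDeriv v f x * φ x := by
  refine integral_mul_fderiv_eq_neg_fderiv_mul_of_integrable ?_ ?_ ?_ ?_ ?_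
  · exact integrable_mul_of_tsupport_subset hU (hf.continuousOn_dirDeriv hU v)
      hφ.continuous.continuousOn hc hs
  · exact integrable_mul_of_tsupport_subset hU hf.continuousOn
      (hφ.dirDeriv v).continuous.continuousOn (hc.dirDeriv v)
      ((tsupport_dirDeriv_subset φ v).trans hs)
  · exact integrable_mul_of_tsupport_subset hU hf.continuousOn
      hφ.continuous.continuousOn hc hs
  · exact fun x hx => (hf.contDiffAt (hU.mem_nhds (hs hx))).differentiableAt (by simp)
  · exact fun x _ => hφ.contDiffAt.differentiableAt (by simp)

theorem integral_sum_mul_partialDeriv {F : Fin n → EuclideanSpace ℝ (Fin n) → ℝ}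
    {φ : EuclideanSpace ℝ (Fin n) → ℝ} (hU : IsOpen U)
    (hF : ∀ i, ContDiffOn ℝ 1 (F i) U) (hφ : ContDiff ℝ ∞ φ) (hc : HasCompactSupport φ)
    (hs : tsupport φ ⊆ U) :
    ∫ x, ∑ i, F i x * partialDeriv i φ x = -∫ x, (∑ i, partialDeriv i (F i) x) * φ x := by
  simp_rw [Finset.sum_mul]
  rw [integral_finsetSum, integral_finsetSum, ← Finset.sum_neg_distrib]
  · exact Finset.sum_congr rfl fun i _ => integral_mul_dirDeriv hU (hF i) hφ hc hs _
  · exact fun i _ => integrable_mul_of_tsupport_subset hU ((hF i).continuousOn_dirDeriv hU _)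
      hφ.continuous.continuousOn hc hs
  · exact fun i _ => integrable_mul_of_tsupport_subset hU (hF i).continuousOn
      (hφ.dirDeriv _).continuous.continuousOn (hc.dirDeriv _)
      ((tsupport_dirDeriv_subset φ _).trans hs)

variable {u : EuclideanSpace ℝ (Fin n) → ℝ}

theorem WeaklyHarmonicOn.laplacian_eq_zero (h : WeaklyHarmonicOn u U) (hU : IsOpen U)
    (hu : ContDiffOn ℝ 2 u U) {x : EuclideanSpace ℝ (Fin n)} (hx : x ∈ U) :
    ∑ i, partialDeriv i (partialDeriv i u) x = 0 := by
  have hcont : ContinuousOn (fun x => ∑ i, partialDeriv i (partialDeriv i u) x) U :=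
    continuousOn_finsetSum _ fun i _ =>
      (hu.dirDeriv (m := 1) hU (by norm_num) _).continuousOn_dirDeriv hU _
  have hae := hU.ae_eq_zero_of_integral_contDiff_smul_eq_zero (μ := volume)
    (hcont.locallyIntegrableOn hU.measurableSet) (fun φ hφ hc hs => by
      have := integral_sum_mul_partialDeriv hU
        (fun i => hu.dirDeriv (m := 1) hU (by norm_num) (EuclideanSpace.single i (1 : ℝ))) hφ hc hs
      rw [h φ hφ hc hs, zero_eq_neg] at this
      simpa [mul_comm] using this)
  have := Measure.eqOn_open_of_ae_eq (μ := volume) (U := U) (g := fun _ => (0 : ℝ))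
    ((ae_restrict_iff' hU.measurableSet).2 hae) hU hcont continuousOn_const
  exact this hx

end IntegrationByParts

section Primitive

theorem hasDerivAt_primitive {θ : ℝ → ℝ} (hθ : Continuous θ) (t : ℝ) :
    HasDerivAt (fun t => ∫ s in (0 : ℝ)..t, θ s) (θ t) t :=
  intervalIntegral.integral_hasDerivAt_right (hθ.intervalIntegrable _ _)
    (hθ.stronglyMeasurableAtFilter _ _) hθ.continuousAt

theorem contDiff_primitive {θ : ℝ → ℝ} (hθ : ContDiff ℝ ∞ θ) :
    ContDiff ℝ ∞ (fun t => ∫ s in (0 : ℝ)..t, θ s) := by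
  rw [contDiff_infty_iff_deriv]
  refine ⟨fun t => (hasDerivAt_primitive hθ.continuous t).differentiableAt, ?_⟩
  rwa [show deriv (fun t => ∫ s in (0 : ℝ)..t, θ s) = θ from
    funext fun t => (hasDerivAt_primitive hθ.continuous t).deriv]

end Primitive

section Weyl

variable {n : ℕ}

theorem fderiv_apply_eq_sum_partialDeriv (f : EuclideanSpace ℝ (Fin n) → ℝ)
    (x y : EuclideanSpace ℝ (Fin n)) :
    fderiv ℝ f x y = ∑ i, y i * partialDeriv i f x := by
  conv_lhs => rw [← (EuclideanSpace.basisFun (Fin n) ℝ).sum_repr y]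
  simp [dirDeriv]

theorem contDiff_mul_of_tsupport_subset {k : ℕ∞ω} {f φ : EuclideanSpace ℝ (Fin n) → ℝ}
    {U : Set (EuclideanSpace ℝ (Fin n))} (hU : IsOpen U) (hφ : ContDiff ℝ k φ)
    (hf : ContDiffOn ℝ k f U) (hs : tsupport φ ⊆ U) : ContDiff ℝ k (fun x => φ x * f x) := by
  rw [contDiff_iff_contDiffAt]
  intro x
  by_cases hx : x ∈ tsupport φ
  · exact hφ.contDiffAt.mul (hf.contDiffAt (hU.mem_nhds (hs hx)))
  · refine contDiffAt_const (c := (0 : ℝ)) |>.congr_of_eventuallyEq ?_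
    filter_upwards [notMem_tsupport_iff_eventuallyEq.1 hx] with y hy
    simp [hy]

/-- A radial smooth mollifier supported in the unit ball. -/
noncomputable def radialBump (y : EuclideanSpace ℝ (Fin n)) : ℝ :=
  Real.smoothTransition (1 - ‖y‖ ^ 2)

/-- A compactly supported function with gradient `y ↦ radialBump y • y`. -/
noncomputable def radialPotential (y : EuclideanSpace ℝ (Fin n)) : ℝ :=
  ((∫ s in (0 : ℝ)..‖y‖ ^ 2, Real.smoothTransition (1 - s)) -
    ∫ s in (0 : ℝ)..1, Real.smoothTransition (1 - s)) / 2

theorem contDiff_smoothTransition_one_sub :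
    ContDiff ℝ ∞ (fun s : ℝ => Real.smoothTransition (1 - s)) :=
  Real.smoothTransition.contDiff.comp (contDiff_const.sub contDiff_id)

theorem contDiff_radialBump : ContDiff ℝ ∞ (radialBump (n := n)) :=
  contDiff_smoothTransition_one_sub.comp (contDiff_norm_sq ℝ)

theorem contDiff_radialPotential : ContDiff ℝ ∞ (radialPotential (n := n)) :=
  (((contDiff_primitive contDiff_smoothTransition_one_sub).comp (contDiff_norm_sq ℝ)).sub
    contDiff_const).div_const 2

theorem radialBump_nonneg (y : EuclideanSpace ℝ (Fin n)) : 0 ≤ radialBump y :=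
  Real.smoothTransition.nonneg _

theorem hasCompactSupport_radialBump : HasCompactSupport (radialBump (n := n)) := by
  refine HasCompactSupport.intro (isCompact_closedBall 0 1) fun y hy => ?_
  rw [mem_closedBall_zero_iff, not_le] at hy
  exact Real.smoothTransition.zero_of_nonpos (by nlinarith)

theorem integral_radialBump_pos : 0 < ∫ y, radialBump (n := n) y :=
  contDiff_radialBump.continuous.integral_pos_of_hasCompactSupport_nonneg_nonzero
    hasCompactSupport_radialBump radialBump_nonneg (x := 0)
    (by simp [radialBump])

theorem radialPotential_eq_zero {y : EuclideanSpace ℝ (Fin n)} (hy : 1 ≤ ‖y‖) :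
    radialPotential y = 0 := by
  have hc := contDiff_smoothTransition_one_sub.continuous
  rw [radialPotential, intervalIntegral.integral_interval_sub_left (hc.intervalIntegrable _ _)
    (hc.intervalIntegrable _ _)]
  have h1 : 1 ≤ ‖y‖ ^ 2 := by nlinarith
  rw [intervalIntegral.integral_congr (g := fun _ => (0 : ℝ))]
  · simp
  · intro s hs
    rw [uIcc_of_le h1] at hs
    exact Real.smoothTransition.zero_of_nonpos (by linarith [hs.1])

theorem fderiv_radialPotential (y v : EuclideanSpace ℝ (Fin n)) :
    fderiv ℝ radialPotential y v = radialBump y * inner ℝ y v := by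
  have h1 := hasDerivAt_primitive contDiff_smoothTransition_one_sub.continuous (‖y‖ ^ 2)
  have h2 := (h1.sub_const
    (∫ s in (0 : ℝ)..1, Real.smoothTransition (1 - s))).div_const 2
  have h3 : HasFDerivAt (fun y : EuclideanSpace ℝ (Fin n) => ‖y‖ ^ 2) (2 • innerSL ℝ y) y :=
    (hasStrictFDerivAt_norm_sq y).hasFDerivAt
  have h4 : HasFDerivAt radialPotential _ y :=
    HasDerivAt.comp_hasFDerivAt (f := fun y : EuclideanSpace ℝ (Fin n) => ‖y‖ ^ 2) y h2 h3
  rw [h4.fderiv]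
  simp [radialBump]
  ring

theorem integral_comp_inv_smul_sub {t : ℝ} (ht : 0 < t) (k : EuclideanSpace ℝ (Fin n) → ℝ)
    (x : EuclideanSpace ℝ (Fin n)) : ∫ z, k (t⁻¹ • (z - x)) = t ^ n * ∫ y, k y := by
  rw [integral_sub_right_eq_self (fun z => k (t⁻¹ • z)) x,
    Measure.integral_comp_inv_smul_of_nonneg _ _ ht.le]
  simp

/-- The radial averages `t ↦ ∫ u (x + t y) ρ(y) dy` of a weakly harmonic function are
stationary. -/
theorem WeaklyHarmonicOn.integral_fderiv_mul_radialBump {u : EuclideanSpace ℝ (Fin n) → ℝ}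
    {U : Set (EuclideanSpace ℝ (Fin n))} {x : EuclideanSpace ℝ (Fin n)} {t : ℝ} (ht : 0 < t)
    (hu : WeaklyHarmonicOn u U)
    (hx : closedBall x t ⊆ U) :
    ∫ y, fderiv ℝ u (x + t • y) y * radialBump y = 0 := by
  set φ : EuclideanSpace ℝ (Fin n) → ℝ := fun z => radialPotential (t⁻¹ • (z - x)) with hφ
  have hφs : ContDiff ℝ ∞ φ :=
    contDiff_radialPotential.comp (f := fun z => t⁻¹ • (z - x)) (by fun_prop)
  have hφ0 : ∀ z, z ∉ closedBall x t → φ z = 0 := by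
    intro z hz
    rw [mem_closedBall, not_le, dist_eq_norm] at hz
    refine radialPotential_eq_zero ?_
    rw [norm_smul, Real.norm_of_nonneg (by positivity), ← div_eq_inv_mul, one_le_div ht]
    exact hz.le
  have hsub : tsupport φ ⊆ closedBall x t :=
    closure_minimal (fun z hz => by_contra fun h => hz (hφ0 z h)) isClosed_closedBall
  have h0 := hu φ hφs (HasCompactSupport.intro (isCompact_closedBall x t) hφ0) (hsub.trans hx)
  have hd : ∀ i z, partialDeriv i φ z =
      t⁻¹ * (radialBump (t⁻¹ • (z - x)) * (t⁻¹ • (z - x)) i) := by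
    intro i z
    have h1 : HasFDerivAt (fun z : EuclideanSpace ℝ (Fin n) => t⁻¹ • (z - x))
        (t⁻¹ • ContinuousLinearMap.id ℝ _) z :=
      ((hasFDerivAt_id z).sub_const x).const_smul t⁻¹
    have h2 := (contDiff_radialPotential.differentiable (by simp)
      (t⁻¹ • (z - x))).hasFDerivAt.comp z h1
    change fderiv ℝ φ z _ = _
    rw [HasFDerivAt.fderiv (f := φ) h2]
    simp only [ContinuousLinearMap.comp_apply, smul_apply,
      ContinuousLinearMap.id_apply, map_smul, fderiv_radialPotential]
    simp [EuclideanSpace.inner_single_right]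
  have hsum_eq : ∀ z, ∑ i, partialDeriv i u z * partialDeriv i φ z =
      (fun y => t⁻¹ * (fderiv ℝ u (x + t • y) y * radialBump y)) (t⁻¹ • (z - x)) := by
    intro z
    have hz : x + t • t⁻¹ • (z - x) = z := by
      rw [smul_inv_smul₀ ht.ne']
      abel
    simp only [hz, hd]
    rw [fderiv_apply_eq_sum_partialDeriv, Finset.sum_mul, Finset.mul_sum]
    exact Finset.sum_congr rfl fun i _ => by ring
  simp_rw [hsum_eq] at h0
  rw [integral_comp_inv_smul_sub ht (fun y => t⁻¹ * (fderiv ℝ u (x + t • y) y * radialBump y)),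
    integral_const_mul] at h0
  simpa [ht.ne'] using h0

theorem hasDerivAt_integral_comp_mul_radialBump {u : EuclideanSpace ℝ (Fin n) → ℝ}
    (hu : ContDiff ℝ 1 u) (hc : HasCompactSupport u) (x : EuclideanSpace ℝ (Fin n)) (t : ℝ) :
    HasDerivAt (fun t : ℝ => ∫ y, u (x + t • y) * radialBump y)
      (∫ y, fderiv ℝ u (x + t • y) y * radialBump y) t := by
  have hρ := contDiff_radialBump (n := n).continuous
  have hu' : Continuous (fderiv ℝ u) := hu.continuous_fderiv (by simp)
  obtain ⟨C, hC⟩ := (hc.fderiv ℝ).exists_bound_of_continuous hu'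
  refine (hasDerivAt_integral_of_dominated_loc_of_deriv_le (s := univ)
    (F := fun (t : ℝ) y => u (x + t • y) * radialBump y)
    (F' := fun (t : ℝ) y => fderiv ℝ u (x + t • y) y * radialBump y)
    (bound := fun y => C * ‖y‖ * radialBump y) univ_mem ?_ ?_ ?_ ?_ ?_ ?_).2
  · refine Eventually.of_forall fun t => Continuous.aestronglyMeasurable ?_
    have := hu.continuous
    fun_prop
  · refine Continuous.integrable_of_hasCompactSupport ?_ hasCompactSupport_radialBump.mul_left
    have := hu.continuous
    fun_prop
  · exact Continuous.aestronglyMeasurable (by fun_prop)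
  · refine Eventually.of_forall fun y t _ => ?_
    rw [norm_mul, Real.norm_of_nonneg (radialBump_nonneg y)]
    exact mul_le_mul_of_nonneg_right ((fderiv ℝ u _).le_of_opNorm_le (hC _) y)
      (radialBump_nonneg y)
  · exact Continuous.integrable_of_hasCompactSupport (by fun_prop)
      hasCompactSupport_radialBump.mul_left
  · refine Eventually.of_forall fun y t _ => ?_
    have h1 : HasDerivAt (fun t : ℝ => x + t • y) y t := by
      simpa using ((hasDerivAt_id t).smul_const y).const_add x
    exact ((hu.differentiable (by simp) (x + t • y)).hasFDerivAt.comp_hasDerivAt t h1).mul_const _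

theorem WeaklyHarmonicOn.contDiffOn_ball {u : EuclideanSpace ℝ (Fin n) → ℝ}
    (hu : ContDiff ℝ 1 u) (hc : HasCompactSupport u) {x₀ : EuclideanSpace ℝ (Fin n)} {r : ℝ}
    (hr : 0 < r) (hw : WeaklyHarmonicOn u (ball x₀ (2 * r))) :
    ContDiffOn ℝ ∞ u (ball x₀ r) := by
  set ρ : EuclideanSpace ℝ (Fin n) → ℝ := fun w => radialBump (r⁻¹ • w) with hρ
  have hρs : ContDiff ℝ ∞ ρ :=
    contDiff_radialBump.comp (f := fun w => r⁻¹ • w) (by fun_prop)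
  have hρc : HasCompactSupport ρ := hasCompactSupport_radialBump.comp_smul (inv_ne_zero hr.ne')
  have hconv := hρc.contDiff_convolution_right (n := ⊤) (μ := volume)
    (ContinuousLinearMap.mul ℝ ℝ) hu.continuous.locallyIntegrable hρs
  set A : ℝ := ∫ y, radialBump (n := n) y
  have hA : A ≠ 0 := integral_radialBump_pos.ne'
  refine ((contDiff_const (c := A⁻¹ * (r ^ n)⁻¹)).mul hconv).contDiffOn.congr fun x hx => ?_
  have hder := hasDerivAt_integral_comp_mul_radialBump hu hc x
  obtain ⟨t, ht, hslope⟩ := exists_hasDerivAt_eq_slope _ _ hr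
    (fun t _ => (hder t).continuousAt.continuousWithinAt) (fun t _ => hder t)
  have hball : closedBall x t ⊆ ball x₀ (2 * r) := by
    refine closedBall_subset_ball' ?_
    rw [mem_ball] at hx
    linarith [ht.2]
  rw [hw.integral_fderiv_mul_radialBump ht.1 hball, eq_comm, div_eq_zero_iff, sub_eq_zero] at hslope
  have h0 := hslope.resolve_right (by linarith)
  simp only [zero_smul, add_zero, integral_const_mul] at h0
  have h1 : (∫ z, u z * ρ (x - z)) = r ^ n * ∫ y, u (x + r • y) * radialBump y := by
    have : ∀ z, u z * ρ (x - z) =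
        (fun y => u (x + r • y) * radialBump y) (r⁻¹ • (z - x)) := by
      intro z
      have hz : x + r • r⁻¹ • (z - x) = z := by
        rw [smul_inv_smul₀ hr.ne']
        abel
      simp only [hz, hρ, radialBump, norm_smul, norm_sub_rev x z]
    simp_rw [this]
    exact integral_comp_inv_smul_sub hr (fun y => u (x + r • y) * radialBump y) x
  change u x = A⁻¹ * (r ^ n)⁻¹ * ∫ z, u z * ρ (x - z)
  rw [h1, h0]
  field_simp
  rfl

/-- **Weyl's lemma** for continuously differentiable functions. -/
theorem WeaklyHarmonicOn.contDiffOn {u : EuclideanSpace ℝ (Fin n) → ℝ}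
    {U : Set (EuclideanSpace ℝ (Fin n))} (hw : WeaklyHarmonicOn u U) (hU : IsOpen U)
    (hu : ContDiffOn ℝ 1 u U) : ContDiffOn ℝ ∞ u U := by
  intro x₀ hx₀
  obtain ⟨R, hR, hball⟩ := Metric.isOpen_iff.1 hU x₀ hx₀
  set r := R / 4 with hr
  have hr0 : 0 < r := by positivity
  let χ : ContDiffBump x₀ := ⟨2 * r, 3 * r, by positivity, by linarith⟩
  have hχs : tsupport χ ⊆ U := by
    rw [χ.tsupport_eq]
    exact (closedBall_subset_ball (show 3 * r < R by linarith)).trans hball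
  have heq : ∀ x ∈ ball x₀ (2 * r), (fun x => χ x * u x) =ᶠ[𝓝 x] u := by
    intro x hx
    filter_upwards [isOpen_ball.mem_nhds hx] with y hy
    rw [χ.one_of_mem_closedBall (ball_subset_closedBall hy), one_mul]
  have hsm := WeaklyHarmonicOn.contDiffOn_ball (u := fun x => χ x * u x)
    (contDiff_mul_of_tsupport_subset hU χ.contDiff hu hχs) χ.hasCompactSupport.mul_right hr0
    (x₀ := x₀) (by
      intro φ hφ hc hs
      rw [← hw φ hφ hc (hs.trans ((ball_subset_ball (by linarith)).trans hball))]
      refine integral_congr_ae (Eventually.of_forall fun x => ?_)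
      by_cases hx : x ∈ tsupport φ
      · simp only [partialDeriv, dirDeriv_congr (heq x (hs hx))]
      · have : ∀ i, partialDeriv i φ x = 0 := fun i =>
          image_eq_zero_of_notMem_tsupport fun h => hx (tsupport_dirDeriv_subset φ _ h)
        simp [this])
  exact ((hsm.contDiffAt (ball_mem_nhds x₀ hr0)).congr_of_eventuallyEq
    (heq x₀ (mem_ball_self (by positivity))).symm).contDiffWithinAt

end Weyl

section Cutoff

/-- A smooth cutoff that vanishes near `0`, with quantitative decay of `1 - H` and of `H'`. -/
theorem exists_contDiff_eq_zero_near_zero :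
    ∃ (H : ℝ → ℝ) (C : ℝ), ContDiff ℝ ∞ H ∧ (∀ s, |s| ≤ 1 → H s = 0) ∧
      (∀ s, |1 - H s| ≤ 3 * (1 + s ^ 2)⁻¹) ∧ ∀ s, |deriv H s| ≤ C * (1 + s ^ 2)⁻¹ := by
  set H : ℝ → ℝ := fun s => Real.smoothTransition (s ^ 2 - 1) with hH
  have hs : ContDiff ℝ ∞ H := Real.smoothTransition.contDiff.comp (by fun_prop)
  have hH1 : ∀ s, 2 < s ^ 2 → H s = 1 := fun s h =>
    Real.smoothTransition.one_of_one_le (by linarith)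
  have hd : HasCompactSupport fun s => deriv H s * (1 + s ^ 2) := by
    refine HasCompactSupport.intro (isCompact_Icc (a := (-2 : ℝ)) (b := 2)) fun s h => ?_
    have h2 : 2 < s ^ 2 := by
      by_contra! h'
      exact h ⟨by nlinarith, by nlinarith⟩
    have : H =ᶠ[𝓝 s] fun _ => 1 := by
      filter_upwards [(continuous_pow 2).continuousAt.eventually_const_lt h2] with y hy
      exact hH1 y hy
    simp [this.deriv_eq]
  have hd' : Continuous (deriv H) := hs.continuous_deriv (by simp)
  obtain ⟨C, hC⟩ := hd.exists_bound_of_continuous (by fun_prop)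
  refine ⟨H, C, hs, fun s h => ?_, fun s => ?_, fun s => ?_⟩
  · have : s ^ 2 ≤ 1 := (sq_le_one_iff_abs_le_one s).2 h
    exact Real.smoothTransition.zero_of_nonpos (by linarith)
  · rcases le_or_gt (s ^ 2) 2 with h | h
    · rw [abs_of_nonneg (sub_nonneg.2 (Real.smoothTransition.le_one _)), ← div_eq_mul_inv,
        le_div_iff₀ (by positivity)]
      have : 0 ≤ H s := Real.smoothTransition.nonneg _
      nlinarith [sq_nonneg s]
    · rw [hH1 s h, sub_self, abs_zero]
      positivity
  · have := hC s
    rw [norm_mul, Real.norm_eq_abs, Real.norm_of_nonneg (by positivity)] at this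
    rwa [← div_eq_mul_inv, le_div_iff₀ (by positivity)]

end Cutoff

section RegularPoint

variable {n : ℕ}

theorem ContDiffAt.contDiffAt_dirDeriv {f : EuclideanSpace ℝ (Fin n) → ℝ}
    {x : EuclideanSpace ℝ (Fin n)} {k m : ℕ∞ω} (hf : ContDiffAt ℝ k f x)
    (hm : m + 1 ≤ k) (v : EuclideanSpace ℝ (Fin n)) : ContDiffAt ℝ m (dirDeriv v f) x :=
  (hf.fderiv_right hm).clm_apply contDiffAt_const

theorem continuous_of_continuousOn_of_tsupport_subset {f : EuclideanSpace ℝ (Fin n) → ℝ}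
    {U : Set (EuclideanSpace ℝ (Fin n))} (hU : IsOpen U) (hf : ContinuousOn f U)
    (hs : tsupport f ⊆ U) : Continuous f :=
  continuous_of_tsupport fun _ hx => hf.continuousAt (hU.mem_nhds (hs hx))

theorem integral_dirDeriv_eq_zero {φ : EuclideanSpace ℝ (Fin n) → ℝ} (hφ : ContDiff ℝ ∞ φ)
    (hc : HasCompactSupport φ) (v : EuclideanSpace ℝ (Fin n)) : ∫ x, dirDeriv v φ x = 0 := by
  have := integral_mul_dirDeriv (f := fun _ => 1) isOpen_univ contDiffOn_const hφ hc
    (subset_univ _) v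
  simpa [dirDeriv] using this

/-- A level-set estimate: the weight `(1 + (k u)²)⁻¹` concentrates on `{u = 0}` at scale
`1 / k`. -/
theorem mul_integral_inv_one_add_sq_le {u χ : EuclideanSpace ℝ (Fin n) → ℝ}
    {U : Set (EuclideanSpace ℝ (Fin n))} (hU : IsOpen U) (hu : ContDiffOn ℝ 1 u U)
    (hχ : ContDiff ℝ ∞ χ) (hc : HasCompactSupport χ) (hs : tsupport χ ⊆ U)
    (v : EuclideanSpace ℝ (Fin n)) (k : ℝ) :
    k * ∫ x, (1 + (k * u x) ^ 2)⁻¹ * (dirDeriv v u x * χ x) ≤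
      Real.pi / 2 * ∫ x, |dirDeriv v χ x| := by
  have hF : ContDiffOn ℝ 1 (fun x => Real.arctan (k * u x)) U :=
    Real.contDiff_arctan.comp_contDiffOn (contDiffOn_const.mul hu)
  have h1 : ∀ x, k * ((1 + (k * u x) ^ 2)⁻¹ * (dirDeriv v u x * χ x)) =
      dirDeriv v (fun x => Real.arctan (k * u x)) x * χ x := by
    intro x
    by_cases hx : x ∈ tsupport χ
    · have hb : HasDerivAt (fun s => Real.arctan (k * s)) ((1 + (k * u x) ^ 2)⁻¹ * k) (u x) := by
        simpa using! (Real.hasDerivAt_arctan (k * u x)).comp (u x)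
          ((hasDerivAt_id (u x)).const_mul k)
      rw [dirDeriv_comp hb ((hu.contDiffAt (hU.mem_nhds (hs hx))).differentiableAt (by simp))]
      ring
    · simp [image_eq_zero_of_notMem_tsupport hx]
  rw [← integral_const_mul]
  simp_rw [h1]
  rw [← neg_neg (∫ x, _), ← integral_mul_dirDeriv hU hF hχ hc hs, ← integral_const_mul,
    ← integral_neg]
  have hc' := hc.dirDeriv v
  have hχ' := (hχ.dirDeriv v).continuous
  refine integral_mono ?_ ?_ fun x => ?_
  · exact (integrable_mul_of_tsupport_subset hU hF.continuousOn hχ'.continuousOn hc'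
      ((tsupport_dirDeriv_subset χ v).trans hs)).neg
  · exact (hχ'.integrable_of_hasCompactSupport hc').abs.const_mul _
  · refine (neg_le_abs _).trans ?_
    rw [abs_mul]
    refine mul_le_mul_of_nonneg_right ?_ (abs_nonneg _)
    exact abs_le.2 ⟨(Real.neg_pi_div_two_lt_arctan _).le, (Real.arctan_lt_pi_div_two _).le⟩

theorem exists_weaklyHarmonicOn_ball_of_dirDeriv_pos {u : EuclideanSpace ℝ (Fin n) → ℝ}
    {U : Set (EuclideanSpace ℝ (Fin n))} (hU : IsOpen U) (hu : ContDiffOn ℝ 1 u U)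
    (hu2 : ∀ x ∈ U, u x ≠ 0 → ContDiffAt ℝ 2 u x)
    (hΔ : ∀ x ∈ U, u x ≠ 0 → ∑ i, partialDeriv i (partialDeriv i u) x = 0)
    {x₀ v : EuclideanSpace ℝ (Fin n)} (hx₀ : x₀ ∈ U) (hv : 0 < dirDeriv v u x₀) :
    ∃ r > 0, WeaklyHarmonicOn u (ball x₀ r) := by
  have hd := hu.continuousOn_dirDeriv hU v
  obtain ⟨R, hR, hball⟩ := Metric.mem_nhds_iff.1
    (inter_mem (hU.mem_nhds hx₀) ((hd.continuousAt (hU.mem_nhds hx₀)).eventually_const_lt hv))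
  have hBU : ball x₀ R ⊆ U := fun x hx => (hball hx).1
  have hdpos : ∀ x ∈ ball x₀ R, 0 < dirDeriv v u x := fun x hx => (hball hx).2
  replace hd := hd.mono hBU
  have huc := hu.continuousOn.mono hBU
  let χ : ContDiffBump x₀ := ⟨R / 3, R / 2, by positivity, by linarith⟩
  have hχs : tsupport χ ⊆ ball x₀ R := by
    rw [χ.tsupport_eq]
    exact closedBall_subset_ball (show R / 2 < R by linarith)
  refine ⟨R / 3, by positivity, fun φ hφ hc hs => ?_⟩
  have hχ1 : ∀ x ∈ tsupport φ, χ x = 1 := fun x hx =>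
    χ.one_of_mem_closedBall (ball_subset_closedBall (hs hx))
  replace hs := hs.trans (ball_subset_ball (show R / 3 ≤ R by linarith))
  set C₀ := Real.pi / 2 * ∫ x, |dirDeriv v χ x|
  have hC₀ : 0 ≤ C₀ := mul_nonneg (by positivity) (integral_nonneg fun x => abs_nonneg _)
  have hlevel := mul_integral_inv_one_add_sq_le isOpen_ball (hu.mono hBU) χ.contDiff
    χ.hasCompactSupport hχs v
  have hW : ∀ x, 0 ≤ dirDeriv v u x * χ x := by
    intro x
    by_cases hx : x ∈ tsupport χ
    · exact mul_nonneg (hdpos x (hχs hx)).le χ.nonneg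
    · simp [image_eq_zero_of_notMem_tsupport hx]
  have hweight : ∀ k : ℝ, ContinuousOn (fun x => (1 + (k * u x) ^ 2)⁻¹) (ball x₀ R) := fun k =>
    ContinuousOn.inv₀ (by fun_prop) fun x _ => by positivity
  have hWint : ∀ k : ℝ, Integrable fun x => (1 + (k * u x) ^ 2)⁻¹ * (dirDeriv v u x * χ x) := by
    intro k
    simp_rw [← mul_assoc]
    exact integrable_mul_of_tsupport_subset isOpen_ball ((hweight k).mul hd)
      χ.continuous.continuousOn χ.hasCompactSupport hχs
  -- integrals against a kernel concentrated on the zero set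
  have hconc : ∀ q g : EuclideanSpace ℝ (Fin n) → ℝ, ∀ k M C : ℝ, 0 < k → 0 ≤ C → 0 ≤ M →
      (∀ x, |q x| ≤ M * (dirDeriv v u x * χ x)) →
      (∀ x, |g x| ≤ C * (1 + (k * u x) ^ 2)⁻¹) →
      |∫ x, g x * q x| ≤ C * M * C₀ / k := by
    intro q g k M C hk hC hM hq hg
    rw [← Real.norm_eq_abs]
    refine (norm_integral_le_of_norm_le ((hWint k).const_mul (C * M))
      (Eventually.of_forall fun x => ?_)).trans ?_
    · rw [norm_mul]
      refine (mul_le_mul (hg x) (hq x) (abs_nonneg _) (by positivity)).trans_eq ?_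
      ring
    · rw [integral_const_mul, mul_div_assoc]
      refine mul_le_mul_of_nonneg_left ?_ (by positivity)
      rw [le_div_iff₀' hk]
      exact hlevel k
  have hdom : ∀ q : EuclideanSpace ℝ (Fin n) → ℝ, ContinuousOn q (ball x₀ R) →
      tsupport q ⊆ tsupport φ → ∃ M, 0 ≤ M ∧ ∀ x, |q x| ≤ M * (dirDeriv v u x * χ x) := by
    intro q hq hqs
    have hqc : HasCompactSupport q := hc.of_isClosed_subset (isClosed_tsupport _) hqs
    have hcs : HasCompactSupport fun x => (dirDeriv v u x)⁻¹ * q x := hqc.mul_left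
    obtain ⟨M, hM⟩ := hcs.exists_bound_of_continuous
      (continuous_of_continuousOn_of_tsupport_subset isOpen_ball
        ((hd.inv₀ fun x hx => (hdpos x hx).ne').mul hq)
        ((closure_mono (Function.support_mul_subset_right _ q)).trans (hqs.trans hs)))
    refine ⟨M, (norm_nonneg _).trans (hM x₀), fun x => ?_⟩
    by_cases hx : x ∈ tsupport φ
    · have hdx := hdpos x (hs hx)
      have := hM x
      rw [norm_mul, norm_inv, Real.norm_of_nonneg hdx.le, inv_mul_le_iff₀ hdx] at this
      rw [hχ1 x hx, mul_one, mul_comm]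
      exact this
    · rw [image_eq_zero_of_notMem_tsupport fun h => hx (hqs h), abs_zero]
      exact mul_nonneg ((norm_nonneg _).trans (hM x₀)) (hW x)
  obtain ⟨H, C, hH, hH0, hH1, hH'⟩ := exists_contDiff_eq_zero_near_zero
  have hC : 0 ≤ C := by simpa using (abs_nonneg _).trans (hH' 0)
  have hdist : ∀ q : EuclideanSpace ℝ (Fin n) → ℝ, Continuous q → tsupport q ⊆ tsupport φ →
      ∃ M, 0 ≤ M ∧ ∀ k, 0 < k → |(∫ x, q x) - ∫ x, H (k * u x) * q x| ≤ M / k := by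
    intro q hq hqs
    obtain ⟨M, hM0, hM⟩ := hdom q hq.continuousOn hqs
    have hqc : HasCompactSupport q := hc.of_isClosed_subset (isClosed_tsupport _) hqs
    refine ⟨3 * M * C₀, by positivity, fun k hk => ?_⟩
    have h1 : Integrable fun x => H (k * u x) * q x :=
      integrable_mul_of_tsupport_subset isOpen_ball
        (hH.continuous.comp_continuousOn (by fun_prop)) hq.continuousOn hqc (hqs.trans hs)
    rw [← integral_sub (hq.integrable_of_hasCompactSupport hqc) h1]
    have h2 := hconc q (fun x => 1 - H (k * u x)) k M 3 hk (by norm_num) hM0 hM fun x => hH1 _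
    have h3 : ∀ x, q x - H (k * u x) * q x = (1 - H (k * u x)) * q x := fun x => by ring
    simp_rw [h3]
    exact h2
  have hgrad : ∀ i : Fin n, ContinuousOn (partialDeriv i u) (ball x₀ R) := fun i =>
    (hu.continuousOn_dirDeriv hU _).mono hBU
  set E : EuclideanSpace ℝ (Fin n) → ℝ :=
    fun x => ∑ i, partialDeriv i u x * partialDeriv i φ x with hE
  have hEs : tsupport E ⊆ tsupport φ := by
    refine closure_minimal (fun x hx => ?_) (isClosed_tsupport φ)
    by_contra h
    refine hx (Finset.sum_eq_zero fun i _ => ?_)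
    have h0 : partialDeriv i φ x = 0 :=
      image_eq_zero_of_notMem_tsupport fun h' => h (tsupport_dirDeriv_subset φ _ h')
    rw [h0, mul_zero]
  have hEc : Continuous E := continuous_of_continuousOn_of_tsupport_subset isOpen_ball
    (continuousOn_finsetSum _ fun i _ => (hgrad i).mul (hφ.dirDeriv _).continuous.continuousOn)
    (hEs.trans hs)
  obtain ⟨M₁, hM₁0, hM₁⟩ := hdist E hEc hEs
  obtain ⟨M₃, hM₃0, hM₃⟩ := hdom (fun x => dirDeriv v u x * φ x)
    (hd.mul hφ.continuous.continuousOn) (closure_mono (Function.support_mul_subset_right _ _))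
  set A : EuclideanSpace ℝ (Fin n) → ℝ :=
    fun x => χ x * ((∑ i, partialDeriv i u x ^ 2) * (dirDeriv v u x)⁻¹) with hA
  have hAc : Continuous A := continuous_of_continuousOn_of_tsupport_subset isOpen_ball
    (χ.continuous.continuousOn.mul ((continuousOn_finsetSum _ fun i _ => (hgrad i).pow 2).mul
      (hd.inv₀ fun x hx => (hdpos x hx).ne')))
    ((closure_mono (Function.support_mul_subset_left _ _)).trans hχs)
  have hHk : ∀ k s : ℝ, HasDerivAt (fun s => H (k * s)) (deriv H (k * s) * k) s := fun k s => by
    simpa using! (hH.differentiable (by simp) (k * s)).hasDerivAt.comp s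
      ((hasDerivAt_id s).const_mul k)
  have hHkc : ∀ k : ℝ, ContDiff ℝ ∞ (fun s => H (k * s)) := fun k =>
    hH.comp (contDiff_const.mul contDiff_id)
  have hdiff : ∀ x ∈ ball x₀ R, DifferentiableAt ℝ u x := fun x hx =>
    (hu.contDiffAt (hU.mem_nhds (hBU hx))).differentiableAt (by simp)
  have hzero : ∀ (k : ℝ), ∀ x ∈ ball x₀ R, u x = 0 → ∀ᶠ y in 𝓝 x, H (k * u y) = 0 := by
    intro k x hx h0
    have h1 : ContinuousAt (fun y => |k * u y|) x :=
      (continuousAt_const.mul (huc.continuousAt (isOpen_ball.mem_nhds hx))).abs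
    filter_upwards [h1.eventually_lt_const (u := 1) (by simp [h0])] with y hy
    exact hH0 _ hy.le
  have hflux : ∀ k : ℝ, ∫ x, H (k * u x) * E x =
      -∫ x, dirDeriv v (fun x => H (k * u x)) x * (A x * φ x) := by
    intro k
    have hF : ∀ i : Fin n, ContDiffOn ℝ 1 (fun x => H (k * u x) * partialDeriv i u x)
        (ball x₀ R) := by
      intro i x hx
      refine ContDiffAt.contDiffWithinAt ?_
      by_cases h0 : u x = 0
      · refine contDiffAt_const (c := (0 : ℝ)) |>.congr_of_eventuallyEq ?_
        filter_upwards [hzero k x hx h0] with y hy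
        rw [hy, zero_mul]
      · have h2 := hu2 x (hBU hx) h0
        exact (((hHkc k).of_le (by simp)).contDiffAt.comp x (h2.of_le (by norm_num))).mul
          (h2.contDiffAt_dirDeriv (by norm_num) _)
    have hdiv := integral_sum_mul_partialDeriv isOpen_ball hF hφ hc hs
    calc ∫ x, H (k * u x) * E x
        = ∫ x, ∑ i, H (k * u x) * partialDeriv i u x * partialDeriv i φ x := by
          simp_rw [hE, Finset.mul_sum, mul_assoc]
      _ = _ := hdiv
      _ = _ := by
        congr 1
        refine integral_congr_ae (Eventually.of_forall fun x => ?_)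
        by_cases hx : x ∈ tsupport φ
        · have hxB := hs hx
          simp only
          rw [← mul_assoc]
          congr 1
          by_cases h0 : u x = 0
          · have h1 := hzero k x hxB h0
            rw [dirDeriv_eq_zero h1, zero_mul]
            refine Finset.sum_eq_zero fun i _ => dirDeriv_eq_zero ?_
            filter_upwards [h1] with y hy
            rw [hy, zero_mul]
          · have h2 := hu2 x (hBU hxB) h0
            have h3 : DifferentiableAt ℝ (fun x => H (k * u x)) x :=
              (hHk k (u x)).differentiableAt.comp x (hdiff x hxB)
            have h4 : ∀ i : Fin n, partialDeriv i (fun x => H (k * u x) * partialDeriv i u x) x =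
                deriv H (k * u x) * k * partialDeriv i u x ^ 2 +
                  H (k * u x) * partialDeriv i (partialDeriv i u) x := by
              intro i
              rw [partialDeriv, dirDeriv_mul h3 ((h2.contDiffAt_dirDeriv (m := 1)
                (by norm_num) _).differentiableAt (by simp)), dirDeriv_comp (hHk k (u x))
                (hdiff x hxB)]
              ring
            simp_rw [h4]
            rw [Finset.sum_add_distrib, ← Finset.mul_sum, ← Finset.mul_sum, hΔ x (hBU hxB) h0,
              dirDeriv_comp (hHk k (u x)) (hdiff x hxB)]
            simp only [hA]
            rw [hχ1 x hx]
            have := (hdpos x hxB).ne'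
            field_simp
            ring
        · simp [image_eq_zero_of_notMem_tsupport hx]
  have hbound : ∀ ε > 0, |∫ x, E x| ≤ ε * (C * M₃ * C₀) := by
    intro ε hε
    obtain ⟨B, hB, hBA, -⟩ := hAc.exists_contDiff_approx ⊤ (ε := fun _ => ε) continuous_const
      fun _ => hε
    have hBφ : ContDiff ℝ ∞ fun x => B x * φ x := hB.mul hφ
    have hBφs : tsupport (fun x => B x * φ x) ⊆ tsupport φ :=
      closure_mono (Function.support_mul_subset_right _ _)
    have hBφc : HasCompactSupport fun x => B x * φ x := hc.mul_left
    obtain ⟨M₂, hM₂0, hM₂⟩ := hdist _ (hBφ.dirDeriv v).continuous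
      ((tsupport_dirDeriv_subset _ v).trans hBφs)
    simp only [integral_dirDeriv_eq_zero hBφ hBφc, zero_sub] at hM₂
    have hmain : ∀ k : ℝ, 0 < k → |∫ x, E x| ≤ (M₁ + M₂) / k + ε * (C * M₃ * C₀) := by
      intro k hk
      have hHu : ContDiffOn ℝ 1 (fun x => H (k * u x)) (ball x₀ R) :=
        ((hHkc k).of_le (by simp)).comp_contDiffOn (hu.mono hBU)
      have h1 := hM₁ k hk
      have h2 := hM₂ k hk
      rw [integral_mul_dirDeriv isOpen_ball hHu hBφ hBφc (hBφs.trans hs), neg_neg] at h2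
      have h3 : |∫ x, dirDeriv v (fun x => H (k * u x)) x * ((A x - B x) * φ x)| ≤
          ε * (C * M₃ * C₀) := by
        have h4 := hconc (fun x => dirDeriv v u x * ((A x - B x) * φ x))
          (fun x => deriv H (k * u x) * k) k (ε * M₃) (C * k) hk (by positivity) (by positivity)
          (fun x => by
            have hAB : |A x - B x| ≤ ε := by
              rw [abs_sub_comm, ← Real.dist_eq]
              exact (hBA x).le
            rw [mul_left_comm, abs_mul, mul_assoc]
            exact mul_le_mul hAB (hM₃ x) (abs_nonneg _) hε.le)
          (fun x => by
            rw [abs_mul, abs_of_pos hk, mul_right_comm]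
            exact mul_le_mul_of_nonneg_right (hH' _) hk.le)
        have h5 : ∀ x, dirDeriv v (fun x => H (k * u x)) x * ((A x - B x) * φ x) =
            deriv H (k * u x) * k * (dirDeriv v u x * ((A x - B x) * φ x)) := by
          intro x
          by_cases hx : x ∈ tsupport φ
          · rw [dirDeriv_comp (hHk k (u x)) (hdiff x (hs hx)), mul_assoc]
          · simp [image_eq_zero_of_notMem_tsupport hx]
        simp_rw [h5]
        refine h4.trans_eq ?_
        field_simp
      have hi : ∀ D : EuclideanSpace ℝ (Fin n) → ℝ, Continuous D →
          Integrable fun x => dirDeriv v (fun x => H (k * u x)) x * (D x * φ x) := by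
        intro D hD
        simp_rw [← mul_assoc]
        exact integrable_mul_of_tsupport_subset isOpen_ball
          ((hHu.continuousOn_dirDeriv isOpen_ball v).mul hD.continuousOn)
          hφ.continuous.continuousOn hc hs
      have h5 : ∫ x, dirDeriv v (fun x => H (k * u x)) x * ((A x - B x) * φ x) =
          (∫ x, dirDeriv v (fun x => H (k * u x)) x * (A x * φ x)) -
            ∫ x, dirDeriv v (fun x => H (k * u x)) x * (B x * φ x) := by
        rw [← integral_sub (hi A hAc) (hi B hB.continuous)]
        exact integral_congr_ae (Eventually.of_forall fun x => by ring)
      rw [hflux k] at h1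
      rw [h5] at h3
      rw [add_div]
      rw [abs_le] at h1 h2 h3 ⊢
      constructor <;> linarith
    have hlim : Tendsto (fun k : ℝ => (M₁ + M₂) / k + ε * (C * M₃ * C₀)) atTop
        (𝓝 (0 + ε * (C * M₃ * C₀))) :=
      (tendsto_const_nhds.div_atTop tendsto_id).add tendsto_const_nhds
    rw [zero_add] at hlim
    exact ge_of_tendsto hlim ((eventually_gt_atTop 0).mono hmain)
  have hlim : Tendsto (fun ε : ℝ => ε * (C * M₃ * C₀)) (𝓝[>] 0) (𝓝 0) := by
    have : Tendsto (fun ε : ℝ => ε * (C * M₃ * C₀)) (𝓝 0) (𝓝 (0 * (C * M₃ * C₀))) :=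
      tendsto_id.mul_const _
    rw [zero_mul] at this
    exact this.mono_left nhdsWithin_le_nhds
  exact abs_nonpos_iff.1 (ge_of_tendsto hlim (eventually_mem_nhdsWithin.mono hbound))

end RegularPoint

section Bochner

variable {n : ℕ}

/-- A smooth monotone step, constant off `[1, 2]`. -/
theorem exists_contDiff_step :
    ∃ (θ : ℝ → ℝ) (C : ℝ), ContDiff ℝ ∞ θ ∧ (∀ s ≤ 1, θ s = 0) ∧ (∀ s, 2 ≤ s → θ s = 1) ∧
      (∀ s, 0 ≤ θ s) ∧ (∀ s, θ s ≤ 1) ∧ (∀ s, 0 ≤ deriv θ s) ∧ ∀ s, |deriv θ s * s| ≤ C := by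
  set θ : ℝ → ℝ := fun s => Real.smoothTransition (s - 1) with hθ
  have hs : ContDiff ℝ ∞ θ := Real.smoothTransition.contDiff.comp (by fun_prop)
  have h0 : ∀ s ≤ 1, θ s = 0 := fun s h => Real.smoothTransition.zero_of_nonpos (by linarith)
  have h1 : ∀ s, 2 ≤ s → θ s = 1 := fun s h => Real.smoothTransition.one_of_one_le (by linarith)
  have hmono : Monotone θ := fun a b h => Real.smoothTransition.monotone (by linarith)
  have hc : HasCompactSupport fun s => deriv θ s * s := by
    refine HasCompactSupport.intro (isCompact_Icc (a := (1 : ℝ)) (b := 2)) fun s h => ?_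
    have : deriv θ s = 0 := by
      rcases lt_or_ge s 1 with h' | h'
      · have he : θ =ᶠ[𝓝 s] fun _ => 0 := (eventually_lt_nhds h').mono fun y hy => h0 y hy.le
        rw [he.deriv_eq, deriv_const]
      · have h2 : 2 < s := not_le.1 fun h2 => h ⟨h', h2⟩
        have he : θ =ᶠ[𝓝 s] fun _ => 1 := (eventually_gt_nhds h2).mono fun y hy => h1 y hy.le
        rw [he.deriv_eq, deriv_const]
    rw [this, zero_mul]
  obtain ⟨C, hC⟩ := hc.exists_bound_of_continuous
    ((hs.continuous_deriv (by simp)).mul continuous_id)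
  exact ⟨θ, C, hs, h0, h1, fun s => Real.smoothTransition.nonneg _,
    fun s => Real.smoothTransition.le_one _, fun s => hmono.deriv_nonneg, hC⟩

theorem dirDeriv_finset_sum {F : Fin n → EuclideanSpace ℝ (Fin n) → ℝ}
    {x : EuclideanSpace ℝ (Fin n)} (hF : ∀ i, DifferentiableAt ℝ (F i) x)
    (v : EuclideanSpace ℝ (Fin n)) :
    dirDeriv v (fun y => ∑ i, F i y) x = ∑ i, dirDeriv v (F i) x := by
  simp only [dirDeriv]
  rw [fderiv_fun_sum fun i _ => hF i]
  simp

theorem dirDeriv_sq {f : EuclideanSpace ℝ (Fin n) → ℝ} {x : EuclideanSpace ℝ (Fin n)}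
    (hf : DifferentiableAt ℝ f x) (v : EuclideanSpace ℝ (Fin n)) :
    dirDeriv v (fun y => f y ^ 2) x = 2 * (f x * dirDeriv v f x) := by
  simp_rw [pow_two]
  rw [dirDeriv_mul hf hf]
  ring

/-- `f²` is subharmonic where `f` is harmonic. -/
theorem laplacian_sq_nonneg {f : EuclideanSpace ℝ (Fin n) → ℝ} {x : EuclideanSpace ℝ (Fin n)}
    (hf : ContDiffAt ℝ 2 f x) (hΔ : ∑ k, partialDeriv k (partialDeriv k f) x = 0) :
    0 ≤ ∑ k, partialDeriv k (partialDeriv k fun y => f y ^ 2) x := by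
  have h1 : ∀ k : Fin n, partialDeriv k (partialDeriv k fun y => f y ^ 2) x =
      2 * partialDeriv k f x ^ 2 + 2 * f x * partialDeriv k (partialDeriv k f) x := by
    intro k
    have hev : (partialDeriv k fun y => f y ^ 2) =ᶠ[𝓝 x]
        fun y => (2 * f y) * partialDeriv k f y := by
      filter_upwards [hf.eventually (by simp)] with y hy
      rw [partialDeriv, dirDeriv_sq (hy.differentiableAt (by simp)), mul_assoc]
    have hfd : DifferentiableAt ℝ f x := hf.differentiableAt (by simp)
    have h2 : partialDeriv k (fun y => 2 * f y) x = 2 * partialDeriv k f x := by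
      have hb : HasDerivAt (fun s : ℝ => 2 * s) 2 (f x) := by
        simpa using! (hasDerivAt_id (f x)).const_mul 2
      exact dirDeriv_comp hb hfd
    rw [partialDeriv, dirDeriv_congr hev, dirDeriv_mul (hfd.const_mul 2)
      ((hf.contDiffAt_dirDeriv (m := 1) (by norm_num) _).differentiableAt (by simp))]
    rw [show dirDeriv (EuclideanSpace.single k (1 : ℝ)) (fun y => 2 * f y) x = _ from h2]
    ring
  simp_rw [h1]
  rw [Finset.sum_add_distrib, ← Finset.mul_sum, ← Finset.mul_sum, hΔ, mul_zero, add_zero]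
  exact mul_nonneg zero_le_two (Finset.sum_nonneg fun k _ => sq_nonneg _)

theorem laplacian_partialDeriv_eq_zero {f : EuclideanSpace ℝ (Fin n) → ℝ}
    {V : Set (EuclideanSpace ℝ (Fin n))} (hV : IsOpen V) (hf : ContDiffOn ℝ ∞ f V)
    (hΔ : ∀ x ∈ V, ∑ k, partialDeriv k (partialDeriv k f) x = 0)
    {x : EuclideanSpace ℝ (Fin n)} (hx : x ∈ V) (i : Fin n) :
    ∑ k, partialDeriv k (partialDeriv k (partialDeriv i f)) x = 0 := by
  have hd : ∀ {g : EuclideanSpace ℝ (Fin n) → ℝ}, ContDiffOn ℝ ∞ g V → ∀ w,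
      ContDiffOn ℝ ∞ (dirDeriv w g) V := fun hg w => hg.dirDeriv hV (by simp) w
  have h2 : ∀ {g : EuclideanSpace ℝ (Fin n) → ℝ}, ContDiffOn ℝ ∞ g V → ∀ y ∈ V,
      ContDiffAt ℝ 2 g y := fun hg y hy =>
    contDiffAt_infty.1 (hg.contDiffAt (hV.mem_nhds hy)) 2
  have hcomm : ∀ k : Fin n, partialDeriv k (partialDeriv k (partialDeriv i f)) x =
      partialDeriv i (partialDeriv k (partialDeriv k f)) x := by
    intro k
    rw [partialDeriv, dirDeriv_congr (g := partialDeriv i (partialDeriv k f)),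
      dirDeriv_comm (h2 (hd hf _) x hx)]
    filter_upwards [hV.mem_nhds hx] with y hy
    exact dirDeriv_comm (h2 hf y hy)
  simp_rw [hcomm]
  rw [← dirDeriv_finset_sum fun k => (h2 (hd (hd hf _) _) x hx).differentiableAt (by simp)]
  refine dirDeriv_eq_zero ?_
  filter_upwards [hV.mem_nhds hx] with y hy
  exact hΔ y hy

/-- The squared length `|∇f|²`. -/
noncomputable def gradSq (f : EuclideanSpace ℝ (Fin n) → ℝ) (x : EuclideanSpace ℝ (Fin n)) : ℝ :=
  ∑ i, partialDeriv i f x ^ 2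

/-- Bochner: `|∇u|²` is subharmonic where `u` is harmonic. -/
theorem laplacian_gradSq_nonneg {f : EuclideanSpace ℝ (Fin n) → ℝ}
    {V : Set (EuclideanSpace ℝ (Fin n))} (hV : IsOpen V) (hf : ContDiffOn ℝ ∞ f V)
    (hΔ : ∀ x ∈ V, ∑ k, partialDeriv k (partialDeriv k f) x = 0)
    {x : EuclideanSpace ℝ (Fin n)} (hx : x ∈ V) :
    0 ≤ ∑ k, partialDeriv k (partialDeriv k (gradSq f)) x := by
  have hd : ∀ i : Fin n, ContDiffOn ℝ ∞ (partialDeriv i f) V := fun i =>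
    hf.dirDeriv hV (by simp) _
  have hsq : ∀ i : Fin n, ContDiffOn ℝ ∞ (fun y => partialDeriv i f y ^ 2) V := fun i =>
    (hd i).pow 2
  have h2 : ∀ {g : EuclideanSpace ℝ (Fin n) → ℝ}, ContDiffOn ℝ ∞ g V → ∀ y ∈ V,
      ContDiffAt ℝ 2 g y := fun hg y hy =>
    contDiffAt_infty.1 (hg.contDiffAt (hV.mem_nhds hy)) 2
  have h1 : ∀ k : Fin n, partialDeriv k (partialDeriv k (gradSq f)) x =
      ∑ i, partialDeriv k (partialDeriv k fun y => partialDeriv i f y ^ 2) x := by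
    intro k
    rw [← dirDeriv_finset_sum fun i =>
      ((h2 (hsq i) x hx).contDiffAt_dirDeriv (m := 1) (by norm_num) _).differentiableAt (by simp)]
    refine dirDeriv_congr ?_
    filter_upwards [hV.mem_nhds hx] with y hy
    exact dirDeriv_finset_sum (fun i => (h2 (hsq i) y hy).differentiableAt (by simp)) _
  simp_rw [h1]
  rw [Finset.sum_comm]
  exact Finset.sum_nonneg fun i _ => laplacian_sq_nonneg (h2 (hd i) x hx)
    (laplacian_partialDeriv_eq_zero hV hf hΔ hx i)

end Bochner

section CriticalSet

variable {n : ℕ} {u : EuclideanSpace ℝ (Fin n) → ℝ} {U V : Set (EuclideanSpace ℝ (Fin n))}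

theorem gradSq_nonneg (u : EuclideanSpace ℝ (Fin n) → ℝ) (x : EuclideanSpace ℝ (Fin n)) :
    0 ≤ gradSq u x :=
  Finset.sum_nonneg fun _ _ => sq_nonneg _

theorem gradSq_eq_zero_iff {x : EuclideanSpace ℝ (Fin n)} :
    gradSq u x = 0 ↔ ∀ i, partialDeriv i u x = 0 := by
  rw [gradSq, Finset.sum_eq_zero_iff_of_nonneg fun _ _ => sq_nonneg _]
  simp

theorem ContDiffOn.continuousOn_gradSq (hu : ContDiffOn ℝ 1 u U) (hU : IsOpen U) :
    ContinuousOn (gradSq u) U :=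
  continuousOn_finsetSum _ fun _ _ => (hu.continuousOn_dirDeriv hU _).pow 2

theorem ContDiffOn.contDiffOn_gradSq (hu : ContDiffOn ℝ ∞ u V) (hV : IsOpen V) :
    ContDiffOn ℝ ∞ (gradSq u) V :=
  ContDiffOn.sum fun _ _ => (hu.dirDeriv hV (by simp) _).pow 2

theorem eventually_gradSq_lt (hU : IsOpen U) (hu : ContDiffOn ℝ 1 u U)
    {x : EuclideanSpace ℝ (Fin n)} (hx : x ∈ U) (h0 : gradSq u x = 0) {δ : ℝ} (hδ : 0 < δ) :
    ∀ᶠ y in 𝓝 x, gradSq u y < δ :=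
  ((hu.continuousOn_gradSq hU).continuousAt (hU.mem_nhds hx)).eventually_lt_const (by rwa [h0])

theorem contDiffOn_comp_gradSq_mul (hU : IsOpen U) (hu : ContDiffOn ℝ 1 u U) (hV : IsOpen V)
    (huV : ContDiffOn ℝ ∞ u V) (hcrit : ∀ x ∈ U, x ∉ V → gradSq u x = 0)
    {ψ : ℝ → ℝ} (hψ : ContDiff ℝ ∞ ψ) {δ : ℝ} (hδ : 0 < δ) (hψ0 : ∀ s < δ, ψ s = 0)
    {P : EuclideanSpace ℝ (Fin n) → ℝ} (hP : ContDiffOn ℝ ∞ P V) :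
    ContDiffOn ℝ ∞ (fun x => ψ (gradSq u x) * P x) U := by
  intro x hx
  refine ContDiffAt.contDiffWithinAt ?_
  by_cases hxV : x ∈ V
  · exact ((hψ.comp_contDiffOn (huV.contDiffOn_gradSq hV)).mul hP).contDiffAt (hV.mem_nhds hxV)
  · refine contDiffAt_const (c := (0 : ℝ)) |>.congr_of_eventuallyEq ?_
    filter_upwards [eventually_gradSq_lt hU hu hx (hcrit x hx hxV) hδ] with y hy
    rw [hψ0 _ hy, zero_mul]

theorem deriv_eq_zero_of_lt {ψ : ℝ → ℝ} {δ : ℝ} (hψ0 : ∀ s < δ, ψ s = 0) {s : ℝ} (hs : s < δ) :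
    deriv ψ s = 0 := by
  have he : ψ =ᶠ[𝓝 s] fun _ => 0 := (eventually_lt_nhds hs).mono hψ0
  rw [he.deriv_eq, deriv_const]

/-- Product rule for `ψ(|∇u|²) P`, extended by zero across the critical points. -/
theorem dirDeriv_comp_gradSq_mul (hU : IsOpen U) (hu : ContDiffOn ℝ 1 u U) (hV : IsOpen V)
    (huV : ContDiffOn ℝ ∞ u V) (hcrit : ∀ x ∈ U, x ∉ V → gradSq u x = 0)
    {ψ : ℝ → ℝ} (hψ : ContDiff ℝ ∞ ψ) {δ : ℝ} (hδ : 0 < δ) (hψ0 : ∀ s < δ, ψ s = 0)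
    {P : EuclideanSpace ℝ (Fin n) → ℝ} (hP : ContDiffOn ℝ ∞ P V)
    {x : EuclideanSpace ℝ (Fin n)} (hx : x ∈ U) (v : EuclideanSpace ℝ (Fin n)) :
    dirDeriv v (fun x => ψ (gradSq u x) * P x) x =
      deriv ψ (gradSq u x) * (dirDeriv v (gradSq u) x * P x) +
        ψ (gradSq u x) * dirDeriv v P x := by
  by_cases hxV : x ∈ V
  · have hg : DifferentiableAt ℝ (gradSq u) x :=
      ((huV.contDiffOn_gradSq hV).contDiffAt (hV.mem_nhds hxV)).differentiableAt (by simp)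
    have hb : HasDerivAt ψ (deriv ψ (gradSq u x)) (gradSq u x) :=
      (hψ.differentiable (by simp) _).hasDerivAt
    have hψg : DifferentiableAt ℝ (fun y => ψ (gradSq u y)) x := hb.differentiableAt.comp x hg
    rw [dirDeriv_mul hψg
      ((hP.contDiffAt (hV.mem_nhds hxV)).differentiableAt (by simp)), dirDeriv_comp hb hg,
      mul_assoc]
  · have h0 := hcrit x hx hxV
    have hev := eventually_gradSq_lt hU hu hx h0 hδ
    rw [h0, hψ0 0 hδ, deriv_eq_zero_of_lt hψ0 hδ, dirDeriv_eq_zero]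
    · simp
    · filter_upwards [hev] with y hy
      rw [hψ0 _ hy, zero_mul]

/-- An energy estimate for `|∇u|²`, uniform in the cutoff `ψ`. -/
theorem integral_deriv_comp_gradSq_mul_le (hU : IsOpen U) (hu : ContDiffOn ℝ 1 u U)
    (hV : IsOpen V) (huV : ContDiffOn ℝ ∞ u V)
    (hΔ : ∀ x ∈ V, ∑ k, partialDeriv k (partialDeriv k u) x = 0)
    (hcrit : ∀ x ∈ U, x ∉ V → gradSq u x = 0)
    {ψ : ℝ → ℝ} (hψ : ContDiff ℝ ∞ ψ) {δ : ℝ} (hδ : 0 < δ) (hψ0 : ∀ s < δ, ψ s = 0)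
    (hψ_nonneg : ∀ s, 0 ≤ ψ s) (hψ_le : ∀ s, ψ s ≤ 1)
    {χ : EuclideanSpace ℝ (Fin n) → ℝ} (hχ : ContDiff ℝ ∞ χ) (hχ_nonneg : ∀ x, 0 ≤ χ x)
    (hc : HasCompactSupport χ) (hs : tsupport χ ⊆ U) :
    ∫ x, deriv ψ (gradSq u x) * gradSq (gradSq u) x * χ x ≤
      ∑ k : Fin n, ∫ x, gradSq u x * |partialDeriv k (partialDeriv k χ) x| := by
  have hg := huV.contDiffOn_gradSq hV
  have hψ' : ContDiff ℝ ∞ (deriv ψ) := contDiff_infty_iff_deriv.1 hψ |>.2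
  have hdg : ∀ k : Fin n, ContDiffOn ℝ ∞ (partialDeriv k (gradSq u)) V := fun k =>
    hg.dirDeriv hV (by simp) _
  set F : Fin n → EuclideanSpace ℝ (Fin n) → ℝ :=
    fun k x => ψ (gradSq u x) * partialDeriv k (gradSq u) x with hF_def
  have hF : ∀ k, ContDiffOn ℝ 1 (F k) U := fun k =>
    (contDiffOn_comp_gradSq_mul hU hu hV huV hcrit hψ hδ hψ0 (hdg k)).of_le (by simp)
  set B : ℝ → ℝ := fun t => ∫ s in (0 : ℝ)..t, ψ s with hB_def
  have hB : ∀ t, HasDerivAt B (ψ t) t := hasDerivAt_primitive hψ.continuous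
  have hB0 : ∀ s, 0 ≤ s → s < δ → B s = 0 := by
    intro s h0 h
    rw [hB_def]
    simp only
    rw [intervalIntegral.integral_congr (g := fun _ => (0 : ℝ))]
    · simp
    · intro t ht
      rw [uIcc_of_le h0] at ht
      exact hψ0 t (ht.2.trans_lt h)
  have hBle : ∀ s, 0 ≤ s → |B s| ≤ s := by
    intro s h
    have := intervalIntegral.norm_integral_le_of_norm_le_const (a := 0) (b := s) (f := ψ) (C := 1)
      fun t _ => by
        rw [Real.norm_of_nonneg (hψ_nonneg t)]
        exact hψ_le t
    simpa [abs_of_nonneg h] using this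
  have hh : ContDiffOn ℝ 1 (fun x => B (gradSq u x)) U := by
    intro x hx
    refine ContDiffAt.contDiffWithinAt ?_
    by_cases hxV : x ∈ V
    · exact (((contDiff_primitive hψ).comp_contDiffOn hg).contDiffAt (hV.mem_nhds hxV)).of_le
        (by simp)
    · refine contDiffAt_const (c := (0 : ℝ)) |>.congr_of_eventuallyEq ?_
      filter_upwards [eventually_gradSq_lt hU hu hx (hcrit x hx hxV) hδ] with y hy
      exact hB0 _ (gradSq_nonneg u y) hy
  have hdh : ∀ k, ∀ x ∈ U, partialDeriv k (fun x => B (gradSq u x)) x = F k x := by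
    intro k x hx
    by_cases hxV : x ∈ V
    · exact dirDeriv_comp (hB _) ((hg.contDiffAt (hV.mem_nhds hxV)).differentiableAt (by simp))
    · have h0 := hcrit x hx hxV
      simp only [hF_def]
      rw [h0, hψ0 0 hδ, zero_mul]
      refine dirDeriv_eq_zero ?_
      filter_upwards [eventually_gradSq_lt hU hu hx h0 hδ] with y hy
      exact hB0 _ (gradSq_nonneg u y) hy
  have hk : ∀ k : Fin n, ∫ x, partialDeriv k (F k) x * χ x ≤
      ∫ x, gradSq u x * |partialDeriv k (partialDeriv k χ) x| := by
    intro k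
    have h1 := integral_mul_dirDeriv hU (hF k) hχ hc hs (EuclideanSpace.single k (1 : ℝ))
    have hsk := (tsupport_dirDeriv_subset χ (EuclideanSpace.single k (1 : ℝ))).trans hs
    have hχk := hχ.dirDeriv (EuclideanSpace.single k (1 : ℝ))
    have hck := hc.dirDeriv (EuclideanSpace.single k (1 : ℝ))
    have h2 := integral_mul_dirDeriv hU hh hχk hck hsk (EuclideanSpace.single k (1 : ℝ))
    have h3 : ∀ x, partialDeriv k (fun x => B (gradSq u x)) x * partialDeriv k χ x =
        F k x * partialDeriv k χ x := by
      intro x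
      by_cases hx : x ∈ tsupport (partialDeriv k χ)
      · rw [hdh k x (hsk hx)]
      · rw [image_eq_zero_of_notMem_tsupport hx, mul_zero, mul_zero]
    simp_rw [h3] at h2
    rw [h1, neg_neg] at h2
    rw [← h2]
    have hkk := hχk.dirDeriv (EuclideanSpace.single k (1 : ℝ))
    have hskk := (tsupport_dirDeriv_subset (partialDeriv k χ)
      (EuclideanSpace.single k (1 : ℝ))).trans hsk
    have hckk := hck.dirDeriv (EuclideanSpace.single k (1 : ℝ))
    refine integral_mono (integrable_mul_of_tsupport_subset hU hh.continuousOn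
      hkk.continuous.continuousOn hckk hskk) ?_ fun x => ?_
    · refine (integrable_mul_of_tsupport_subset hU (hu.continuousOn_gradSq hU)
        hkk.continuous.continuousOn hckk hskk).abs.congr (Eventually.of_forall fun x => ?_)
      simp only [abs_mul, abs_of_nonneg (gradSq_nonneg u x)]
    · refine (le_abs_self _).trans ?_
      rw [abs_mul]
      exact mul_le_mul_of_nonneg_right (hBle _ (gradSq_nonneg u x)) (abs_nonneg _)
  refine le_trans ?_ (Finset.sum_le_sum fun k _ => hk k)
  have hi : ∀ k, Integrable fun x => partialDeriv k (F k) x * χ x := fun k =>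
    integrable_mul_of_tsupport_subset hU ((hF k).continuousOn_dirDeriv hU _)
      hχ.continuous.continuousOn hc hs
  rw [← integral_finsetSum _ fun k _ => hi k]
  refine integral_mono ?_ (integrable_finsetSum _ fun k _ => hi k) fun x => ?_
  · exact integrable_mul_of_tsupport_subset hU (contDiffOn_comp_gradSq_mul hU hu hV huV hcrit
      hψ' hδ (fun s => deriv_eq_zero_of_lt hψ0) (hg.contDiffOn_gradSq hV)).continuousOn
      hχ.continuous.continuousOn hc hs
  · simp only
    by_cases hx : x ∈ tsupport χ
    · rw [← Finset.sum_mul]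
      refine mul_le_mul_of_nonneg_right ?_ (hχ_nonneg x)
      have h1 : ∀ k, partialDeriv k (F k) x =
          deriv ψ (gradSq u x) * partialDeriv k (gradSq u) x ^ 2 +
          ψ (gradSq u x) * partialDeriv k (partialDeriv k (gradSq u)) x := by
        intro k
        rw [pow_two]
        exact dirDeriv_comp_gradSq_mul hU hu hV huV hcrit hψ hδ hψ0 (hdg k) (hs hx) _
      simp_rw [h1]
      rw [Finset.sum_add_distrib, ← Finset.mul_sum, ← Finset.mul_sum]
      refine le_add_of_nonneg_right ?_
      by_cases hxV : x ∈ V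
      · exact mul_nonneg (hψ_nonneg _) (laplacian_gradSq_nonneg hV huV hΔ hxV)
      · rw [hcrit x (hs hx) hxV, hψ0 0 hδ, zero_mul]
    · simp [image_eq_zero_of_notMem_tsupport hx]

theorem integral_comp_gradSq_mul_eq (hU : IsOpen U) (hu : ContDiffOn ℝ 1 u U)
    (hV : IsOpen V) (huV : ContDiffOn ℝ ∞ u V)
    (hΔ : ∀ x ∈ V, ∑ k, partialDeriv k (partialDeriv k u) x = 0)
    (hcrit : ∀ x ∈ U, x ∉ V → gradSq u x = 0)
    {ψ : ℝ → ℝ} (hψ : ContDiff ℝ ∞ ψ) {δ : ℝ} (hδ : 0 < δ) (hψ0 : ∀ s < δ, ψ s = 0)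
    {φ : EuclideanSpace ℝ (Fin n) → ℝ} (hφ : ContDiff ℝ ∞ φ)
    (hc : HasCompactSupport φ) (hs : tsupport φ ⊆ U) :
    ∫ x, ψ (gradSq u x) * ∑ i, partialDeriv i u x * partialDeriv i φ x =
      -∫ x, deriv ψ (gradSq u x) *
        (∑ i, partialDeriv i (gradSq u) x * partialDeriv i u x) * φ x := by
  have hdu : ∀ i : Fin n, ContDiffOn ℝ ∞ (partialDeriv i u) V := fun i =>
    huV.dirDeriv hV (by simp) _
  have hF : ∀ i : Fin n, ContDiffOn ℝ 1 (fun x => ψ (gradSq u x) * partialDeriv i u x) U :=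
    fun i => (contDiffOn_comp_gradSq_mul hU hu hV huV hcrit hψ hδ hψ0 (hdu i)).of_le (by simp)
  have hdiv := integral_sum_mul_partialDeriv hU hF hφ hc hs
  simp_rw [Finset.mul_sum, ← mul_assoc] at hdiv ⊢
  rw [hdiv]
  congr 1
  refine integral_congr_ae (Eventually.of_forall fun x => ?_)
  simp only
  by_cases hx : x ∈ tsupport φ
  · congr 1
    have h1 : ∀ i, partialDeriv i (fun x => ψ (gradSq u x) * partialDeriv i u x) x = _ := fun i =>
      dirDeriv_comp_gradSq_mul hU hu hV huV hcrit hψ hδ hψ0 (hdu i) (hs hx) _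
    simp_rw [h1]
    rw [Finset.sum_add_distrib, ← Finset.mul_sum, ← Finset.mul_sum]
    by_cases hxV : x ∈ V
    · rw [hΔ x hxV, mul_zero, add_zero, Finset.mul_sum]
      simp_rw [mul_assoc]
    · rw [hcrit x (hs hx) hxV, hψ0 0 hδ, deriv_eq_zero_of_lt hψ0 hδ]
      simp
  · rw [image_eq_zero_of_notMem_tsupport hx, mul_zero, mul_zero]

theorem abs_sum_mul_le_mul_gradSq_add {l : ℝ} (hl : 0 < l)
    (g u : EuclideanSpace ℝ (Fin n) → ℝ) (x : EuclideanSpace ℝ (Fin n)) :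
    |∑ i, partialDeriv i g x * partialDeriv i u x| ≤ l * gradSq g x + l⁻¹ * gradSq u x := by
  rw [gradSq, gradSq, Finset.mul_sum, Finset.mul_sum, ← Finset.sum_add_distrib]
  refine (Finset.abs_sum_le_sum_abs _ _).trans (Finset.sum_le_sum fun i _ => ?_)
  set a := partialDeriv i g x
  set b := partialDeriv i u x
  have h1 : 0 ≤ l⁻¹ * (l * a + b) ^ 2 := by positivity
  have h2 : 0 ≤ l⁻¹ * (l * a - b) ^ 2 := by positivity
  have h3 : l⁻¹ * (l * a + b) ^ 2 = l * a ^ 2 + l⁻¹ * b ^ 2 + 2 * (a * b) := by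
    field_simp
    ring
  have h4 : l⁻¹ * (l * a - b) ^ 2 = l * a ^ 2 + l⁻¹ * b ^ 2 - 2 * (a * b) := by
    field_simp
    ring
  have h5 : 0 ≤ l * a ^ 2 + l⁻¹ * b ^ 2 := by positivity
  exact abs_le.2 ⟨by linarith, by linarith⟩

/-- The critical set of a `C¹` function that is harmonic elsewhere is removable. -/
theorem exists_weaklyHarmonicOn_ball_of_gradSq_eq_zero (hU : IsOpen U) (hu : ContDiffOn ℝ 1 u U)
    (hV : IsOpen V) (huV : ContDiffOn ℝ ∞ u V)
    (hΔ : ∀ x ∈ V, ∑ k, partialDeriv k (partialDeriv k u) x = 0)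
    (hcrit : ∀ x ∈ U, x ∉ V → gradSq u x = 0)
    {x₀ : EuclideanSpace ℝ (Fin n)} (hx₀ : x₀ ∈ U) :
    ∃ r > 0, WeaklyHarmonicOn u (ball x₀ r) := by
  obtain ⟨R, hR, hball⟩ := Metric.isOpen_iff.1 hU x₀ hx₀
  let χ : ContDiffBump x₀ := ⟨R / 3, R / 2, by positivity, by linarith⟩
  have hχs : tsupport χ ⊆ U := by
    rw [χ.tsupport_eq]
    exact (closedBall_subset_ball (show R / 2 < R by linarith)).trans hball
  refine ⟨R / 3, by positivity, fun φ hφ hc hs => ?_⟩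
  have hχ1 : ∀ x ∈ tsupport φ, χ x = 1 := fun x hx =>
    χ.one_of_mem_closedBall (ball_subset_closedBall (hs hx))
  replace hs : tsupport φ ⊆ U :=
    hs.trans ((ball_subset_ball (show R / 3 ≤ R by linarith)).trans hball)
  obtain ⟨M, hM⟩ := hc.exists_bound_of_continuous hφ.continuous
  have hM0 : 0 ≤ M := (norm_nonneg _).trans (hM x₀)
  have hMχ : ∀ x, |φ x| ≤ M * χ x := by
    intro x
    by_cases hx : x ∈ tsupport φ
    · rw [hχ1 x hx, mul_one]
      exact hM x
    · rw [image_eq_zero_of_notMem_tsupport hx, abs_zero]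
      exact mul_nonneg hM0 χ.nonneg
  set E : EuclideanSpace ℝ (Fin n) → ℝ :=
    fun x => ∑ i, partialDeriv i u x * partialDeriv i φ x with hE
  have hEs : tsupport E ⊆ tsupport φ := by
    refine closure_minimal (fun x hx => ?_) (isClosed_tsupport φ)
    by_contra h
    refine hx (Finset.sum_eq_zero fun i _ => ?_)
    have h0 : partialDeriv i φ x = 0 :=
      image_eq_zero_of_notMem_tsupport fun h' => h (tsupport_dirDeriv_subset φ _ h')
    rw [h0, mul_zero]
  have hEc : Continuous E := continuous_of_continuousOn_of_tsupport_subset hU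
    (continuousOn_finsetSum _ fun i _ =>
      (hu.continuousOn_dirDeriv hU _).mul (hφ.dirDeriv _).continuous.continuousOn) (hEs.trans hs)
  have hEcs : HasCompactSupport E := hc.of_isClosed_subset (isClosed_tsupport _) hEs
  have hEi : Integrable E := hEc.integrable_of_hasCompactSupport hEcs
  have hgc := hu.continuousOn_gradSq hU
  obtain ⟨θ, C, hθ, hθ0, hθ1, hθ_nonneg, hθ_le, hθ', hθC⟩ := exists_contDiff_step
  set ψ : ℕ → ℝ → ℝ := fun m s => θ ((m + 1) * s) with hψ_def
  have hm : ∀ m : ℕ, (0 : ℝ) < m + 1 := fun m => by positivity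
  have hψ : ∀ m, ContDiff ℝ ∞ (ψ m) := fun m => hθ.comp (contDiff_const.mul contDiff_id)
  have hδ : ∀ m : ℕ, (0 : ℝ) < (m + 1 : ℝ)⁻¹ := fun m => by positivity
  have hψ0 : ∀ m : ℕ, ∀ s < (m + 1 : ℝ)⁻¹, ψ m s = 0 := fun m s h => by
    refine hθ0 _ ?_
    rw [← le_inv_mul_iff₀ (hm m), mul_one]
    exact h.le
  have hψd : ∀ m s, deriv (ψ m) s = deriv θ ((m + 1) * s) * (m + 1) := fun m s => by
    have h : HasDerivAt (ψ m) (deriv θ ((m + 1) * s) * (m + 1)) s := by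
      simpa using! (hθ.differentiable (by simp) ((m + 1) * s)).hasDerivAt.comp s
        ((hasDerivAt_id s).const_mul ((m : ℝ) + 1))
    exact h.deriv
  have hψd_nonneg : ∀ m s, 0 ≤ deriv (ψ m) s := fun m s => by
    rw [hψd]
    exact mul_nonneg (hθ' _) (hm m).le
  have hψ1 : ∀ s, 0 < s → ∀ᶠ m in atTop, ∀ᶠ t in 𝓝 s, ψ m t = 1 := by
    intro s h
    have hlim : Tendsto (fun m : ℕ => ((m : ℝ) + 1) * s) atTop atTop :=
      (tendsto_atTop_add_const_right _ _ tendsto_natCast_atTop_atTop).atTop_mul_const h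
    filter_upwards [hlim.eventually_gt_atTop 2] with m hm2
    have hcont : ContinuousAt (fun t : ℝ => ((m : ℝ) + 1) * t) s := by fun_prop
    filter_upwards [hcont.eventually_const_lt hm2] with t ht
    exact hθ1 _ ht.le
  set K := ∑ k : Fin n, ∫ x, gradSq u x * |partialDeriv k (partialDeriv k χ) x|
  have hlim1 : Tendsto (fun m => ∫ x, ψ m (gradSq u x) * E x) atTop (𝓝 (∫ x, E x)) := by
    refine tendsto_integral_of_dominated_convergence (fun x => |E x|) (fun m => ?_) hEi.abs
      (fun m => Eventually.of_forall fun x => ?_) (Eventually.of_forall fun x => ?_)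
    · exact (integrable_mul_of_tsupport_subset hU ((hψ m).continuous.comp_continuousOn hgc)
        hEc.continuousOn hEcs (hEs.trans hs)).aestronglyMeasurable
    · rw [norm_mul, Real.norm_of_nonneg (hθ_nonneg _)]
      exact mul_le_of_le_one_left (norm_nonneg _) (hθ_le _)
    · rcases (gradSq_nonneg u x).eq_or_lt with h | h
      · have h0 : E x = 0 := Finset.sum_eq_zero fun i _ => by
          rw [gradSq_eq_zero_iff.1 h.symm i, zero_mul]
        simp [h0]
      · refine tendsto_const_nhds.congr' ?_
        filter_upwards [hψ1 _ h] with m hm1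
        rw [hm1.self_of_nhds, one_mul]
  have hintegrable2 : ∀ m, Integrable fun x => deriv (ψ m) (gradSq u x) * gradSq u x * χ x := fun m =>
    integrable_mul_of_tsupport_subset hU
      ((((hψ m).continuous_deriv (by simp)).comp_continuousOn hgc).mul hgc)
      χ.continuous.continuousOn χ.hasCompactSupport hχs
  have hlim2 : Tendsto (fun m => ∫ x, deriv (ψ m) (gradSq u x) * gradSq u x * χ x) atTop
      (𝓝 0) := by
    rw [← integral_zero (EuclideanSpace ℝ (Fin n)) ℝ (μ := volume)]
    refine tendsto_integral_of_dominated_convergence (fun x => C * χ x)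
      (fun m => (hintegrable2 m).aestronglyMeasurable)
      ((χ.continuous.integrable_of_hasCompactSupport χ.hasCompactSupport).const_mul C)
      (fun m => Eventually.of_forall fun x => ?_) (Eventually.of_forall fun x => ?_)
    · rw [norm_mul, Real.norm_of_nonneg χ.nonneg, hψd, mul_assoc (deriv θ _)]
      exact mul_le_mul_of_nonneg_right (hθC _) χ.nonneg
    · rcases (gradSq_nonneg u x).eq_or_lt with h | h
      · simp [← h]
      · refine tendsto_const_nhds.congr' ?_
        filter_upwards [hψ1 _ h] with m hm1
        have he : ψ m =ᶠ[𝓝 (gradSq u x)] fun _ => 1 := hm1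
        rw [he.deriv_eq, deriv_const, zero_mul, zero_mul]
  have hbound : ∀ l > 0, |∫ x, E x| ≤ l * (M * K) := by
    intro l hl
    have hle : ∀ m, |∫ x, ψ m (gradSq u x) * E x| ≤ l * (M * K) +
        M * l⁻¹ * ∫ x, deriv (ψ m) (gradSq u x) * gradSq u x * χ x := by
      intro m
      rw [integral_comp_gradSq_mul_eq hU hu hV huV hΔ hcrit (hψ m) (hδ m) (hψ0 m) hφ hc hs,
        abs_neg, ← Real.norm_eq_abs]
      have hintegrable1 : Integrable fun x => deriv (ψ m) (gradSq u x) * gradSq (gradSq u) x * χ x :=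
        integrable_mul_of_tsupport_subset hU (contDiffOn_comp_gradSq_mul hU hu hV huV hcrit
          (contDiff_infty_iff_deriv.1 (hψ m)).2 (hδ m) (fun s => deriv_eq_zero_of_lt (hψ0 m))
          ((huV.contDiffOn_gradSq hV).contDiffOn_gradSq hV)).continuousOn
          χ.continuous.continuousOn χ.hasCompactSupport hχs
      refine (norm_integral_le_of_norm_le
        ((hintegrable1.const_mul (l * M)).add ((hintegrable2 m).const_mul (M * l⁻¹)))
        (Eventually.of_forall fun x => ?_)).trans ?_
      · rw [norm_mul, norm_mul, Real.norm_of_nonneg (hψd_nonneg m _)]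
        refine (mul_le_mul (mul_le_mul_of_nonneg_left
          (abs_sum_mul_le_mul_gradSq_add hl (gradSq u) u x) (hψd_nonneg m _)) (hMχ x)
          (abs_nonneg _) ?_).trans_eq ?_
        · exact mul_nonneg (hψd_nonneg m _) (add_nonneg (mul_nonneg hl.le (gradSq_nonneg _ _))
            (mul_nonneg (inv_nonneg.2 hl.le) (gradSq_nonneg _ _)))
        · simp only [Pi.add_apply]
          ring
      · rw [integral_add' (hintegrable1.const_mul _) ((hintegrable2 m).const_mul _), integral_const_mul,
          integral_const_mul, ← mul_assoc l]
        gcongr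
        exact integral_deriv_comp_gradSq_mul_le hU hu hV huV hΔ hcrit (hψ m) (hδ m) (hψ0 m)
          (fun s => hθ_nonneg _) (fun s => hθ_le _) χ.contDiff (fun x => χ.nonneg)
          χ.hasCompactSupport hχs
    refine le_of_tendsto_of_tendsto' hlim1.abs ?_ hle
    simpa using (hlim2.const_mul (M * l⁻¹)).const_add (l * (M * K))
  have hlim : Tendsto (fun l : ℝ => l * (M * K)) (𝓝[>] 0) (𝓝 0) := by
    have : Tendsto (fun l : ℝ => l * (M * K)) (𝓝 0) (𝓝 (0 * (M * K))) := tendsto_id.mul_const _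
    rw [zero_mul] at this
    exact this.mono_left nhdsWithin_le_nhds
  exact abs_nonpos_iff.1 (ge_of_tendsto hlim (eventually_mem_nhdsWithin.mono hbound))

end CriticalSet

section Localization

variable {n : ℕ} {u : EuclideanSpace ℝ (Fin n) → ℝ} {U V : Set (EuclideanSpace ℝ (Fin n))}

theorem WeaklyHarmonicOn.mono (h : WeaklyHarmonicOn u U) (hVU : V ⊆ U) : WeaklyHarmonicOn u V :=
  fun φ hφ hc hs => h φ hφ hc (hs.trans hVU)

/-- The points near which `u` is weakly harmonic. -/
def weaklyHarmonicLocus (u : EuclideanSpace ℝ (Fin n) → ℝ) : Set (EuclideanSpace ℝ (Fin n)) :=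
  {x | ∃ r > 0, WeaklyHarmonicOn u (ball x r)}

theorem isOpen_weaklyHarmonicLocus (u : EuclideanSpace ℝ (Fin n) → ℝ) :
    IsOpen (weaklyHarmonicLocus u) := by
  refine Metric.isOpen_iff.2 fun x ⟨r, hr, h⟩ => ⟨r, hr, fun y hy => ?_⟩
  obtain ⟨ε, hε, hball⟩ := Metric.isOpen_iff.1 isOpen_ball y hy
  exact ⟨ε, hε, h.mono hball⟩

theorem contDiffOn_and_laplacian_eq_zero_of_subset_weaklyHarmonicLocus (hU : IsOpen U)
    (hu : ContDiffOn ℝ 1 u U) (hsub : U ⊆ weaklyHarmonicLocus u) :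
    ContDiffOn ℝ ∞ u U ∧ ∀ x ∈ U, ∑ k, partialDeriv k (partialDeriv k u) x = 0 := by
  have h : ∀ x ∈ U, ContDiffAt ℝ ∞ u x ∧ ∑ k, partialDeriv k (partialDeriv k u) x = 0 := by
    intro x hx
    obtain ⟨r, hr, hw⟩ := hsub hx
    have hO : IsOpen (ball x r ∩ U) := isOpen_ball.inter hU
    have hxO : x ∈ ball x r ∩ U := ⟨mem_ball_self hr, hx⟩
    have hwO := hw.mono (inter_subset_left (t := U))
    have hs := hwO.contDiffOn hO (hu.mono inter_subset_right)
    exact ⟨hs.contDiffAt (hO.mem_nhds hxO),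
      hwO.laplacian_eq_zero hO (contDiffOn_infty.1 hs 2) hxO⟩
  exact ⟨fun x hx => (h x hx).1.contDiffWithinAt, fun x hx => (h x hx).2⟩

end Localization

/-- Let `n ≥ 2`, let `Ω ⊆ ℝⁿ` be open, let `u : Ω → ℝ` be continuously
differentiable on `Ω`, and let `K ⊆ {x ∈ Ω : u x = 0}` be relatively closed in `Ω`.
If `u` is harmonic on `Ω \ K`, then `u` is harmonic on all of `Ω`. -/
theorem zero_set_removable_for_C1_harmonic
    {n : ℕ} (hn : 2 ≤ n) (Ω : Set (EuclideanSpace ℝ (Fin n))) (hΩ : IsOpen Ω)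
    (u : EuclideanSpace ℝ (Fin n) → ℝ) (hu : ContDiffOn ℝ 1 u Ω)
    (K : Set (EuclideanSpace ℝ (Fin n)))
    (hKsub : K ⊆ {x ∈ Ω | u x = 0})
    (hKclosed : closure K ∩ Ω ⊆ K)
    (hharm : HarmonicOnE u (Ω \ K)) :
    HarmonicOnE u Ω := by
  have hO : IsOpen (Ω \ K) := by
    have : Ω \ K = Ω \ closure K := by
      ext x
      exact ⟨fun h => ⟨h.1, fun hx => h.2 (hKclosed ⟨hx, h.1⟩)⟩,
        fun h => ⟨h.1, fun hx => h.2 (subset_closure hx)⟩⟩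
    rw [this]
    exact hΩ.sdiff isClosed_closure
  have h2 : ∀ x ∈ Ω \ K, ContDiffAt ℝ 2 u x := fun x hx =>
    hharm.1.contDiffAt (hO.mem_nhds hx)
  have hΔ : ∀ x ∈ Ω \ K, ∑ k, partialDeriv k (partialDeriv k u) x = 0 := fun x hx => by
    rw [← eLaplacian_eq_sum_partialDeriv (h2 x hx)]
    exact hharm.2 x hx
  have hmem : ∀ x ∈ Ω, u x ≠ 0 → x ∈ Ω \ K := fun x hx h0 => ⟨hx, fun hK => h0 (hKsub hK).2⟩
  have hreg : ∀ x ∈ Ω, ∀ v, 0 < dirDeriv v u x → x ∈ weaklyHarmonicLocus u := fun x hx v hv =>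
    exists_weaklyHarmonicOn_ball_of_dirDeriv_pos hΩ hu (fun y hy h0 => h2 y (hmem y hy h0))
      (fun y hy h0 => hΔ y (hmem y hy h0)) hx hv
  set V := Ω ∩ weaklyHarmonicLocus u
  have hV : IsOpen V := hΩ.inter (isOpen_weaklyHarmonicLocus u)
  obtain ⟨huV, hΔV⟩ := contDiffOn_and_laplacian_eq_zero_of_subset_weaklyHarmonicLocus hV
    (hu.mono inter_subset_left) inter_subset_right
  have hcrit : ∀ x ∈ Ω, x ∉ V → gradSq u x = 0 := by
    intro x hx hxV
    refine gradSq_eq_zero_iff.2 fun i => ?_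
    by_contra h
    rcases lt_or_gt_of_ne h with h | h
    · refine hxV ⟨hx, hreg x hx (-EuclideanSpace.single i 1) ?_⟩
      rw [dirDeriv, map_neg]
      exact neg_pos.2 h
    · exact hxV ⟨hx, hreg x hx _ h⟩
  obtain ⟨hs, hΔu⟩ := contDiffOn_and_laplacian_eq_zero_of_subset_weaklyHarmonicLocus hΩ hu
    fun x hx => exists_weaklyHarmonicOn_ball_of_gradSq_eq_zero hΩ hu hV huV hΔV hcrit hx
  have hs2 : ContDiffOn ℝ 2 u Ω := contDiffOn_infty.1 hs 2
  refine ⟨hs2, fun x hx => ?_⟩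
  rw [eLaplacian_eq_sum_partialDeriv (hs2.contDiffAt (hΩ.mem_nhds hx))]
  exact hΔu x hx
end

section
/- Let n ≥ 1 and let u be harmonic on B_1 ⊂ ℝ^n and positively homogeneous of degree one on B_1, i.e. u(t·x) = t·u(x) for all x ∈ B_1 and all t ∈ (0,1]. Then there is a linear map ℓ : ℝ^n → ℝ such that u(x) = ℓ(x) for all x ∈ B_1. -/
open Set Metric

/-- Let `n ≥ 1` and let `u` be harmonic on `B₁ ⊂ ℝⁿ` and positively
homogeneous of degree one on `B₁`, i.e. `u (t • x) = t * u x` for all `x ∈ B₁` and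
`t ∈ (0, 1]`.  Then there is a linear map `ℓ : ℝⁿ → ℝ` with `u = ℓ` on `B₁`. -/
theorem homogeneous_degree_one_harmonic_is_linear
    {n : ℕ} (hn : 1 ≤ n) (u : EuclideanSpace ℝ (Fin n) → ℝ)
    (hharm : HarmonicOnE u (ball (0 : EuclideanSpace ℝ (Fin n)) 1))
    (hhom : ∀ x ∈ ball (0 : EuclideanSpace ℝ (Fin n)) 1, ∀ t ∈ Ioc (0 : ℝ) 1,
      u (t • x) = t * u x) :
    ∃ ℓ : EuclideanSpace ℝ (Fin n) →ₗ[ℝ] ℝ,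
      ∀ x ∈ ball (0 : EuclideanSpace ℝ (Fin n)) 1, u x = ℓ x := by
  have hball : ball (0 : EuclideanSpace ℝ (Fin n)) 1 ∈ nhds 0 := ball_mem_nhds 0 one_pos
  have hdiff : DifferentiableAt ℝ u 0 :=
    (hharm.1.contDiffAt hball).differentiableAt (by norm_num)
  have hzero : u 0 = 0 := by
    have h := hhom 0 (mem_ball_self one_pos) (1 / 2) ⟨by norm_num, by norm_num⟩
    rw [smul_zero] at h
    linarith
  refine ⟨(fderiv ℝ u 0).toLinearMap, fun x hx => ?_⟩
  have hline : HasDerivAt (fun t : ℝ => t • x) x 0 := by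
    simpa using (hasDerivAt_id (0 : ℝ)).smul_const x
  have hray : HasDerivWithinAt (fun t : ℝ => u (t • x)) (fderiv ℝ u 0 x) (Icc 0 1) 0 := by
    have hu : HasFDerivAt u (fderiv ℝ u 0) ((0 : ℝ) • x) := by
      rw [zero_smul]
      exact hdiff.hasFDerivAt
    exact (hu.comp_hasDerivAt (0 : ℝ) hline).hasDerivWithinAt
  have hlin : HasDerivWithinAt (fun t : ℝ => u (t • x)) (u x) (Icc 0 1) 0 := by
    have hmul : HasDerivWithinAt (fun t : ℝ => t * u x) (u x) (Icc 0 1) 0 := by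
      simpa using ((hasDerivAt_id (0 : ℝ)).mul_const (u x)).hasDerivWithinAt
    refine hmul.congr (fun t ht => ?_) (by simp [hzero])
    rcases ht.1.eq_or_lt with rfl | hpos
    · simp [hzero]
    · exact hhom x hx t ⟨hpos, ht.2⟩
  exact (uniqueDiffOn_Icc zero_lt_one 0 (left_mem_Icc.2 zero_le_one)).eq_deriv _ hlin hray
end

section
/- Let n ≥ 1 and let u be harmonic on B_1 ⊂ ℝ^n. Suppose that u(t·x) = t·u(x) whenever t > 0, x ∈ B_1 \ B̄_{1/2}, and t·x ∈ B_1 \ B̄_{1/2}. Then u(t·x) = t·u(x) for all x ∈ B_1 and all t ∈ (0,1]; that is, positive homogeneity of degree one on the annulus B_1 \ B̄_{1/2} propagates, by unique continuation, to positive homogeneity of degree one on all of B_1. -/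
open Set Metric

open Filter Topology

/-- Second order necessary condition for a local maximum on the real line. -/
lemma IsLocalMax.second_deriv_nonpos {g g' : ℝ → ℝ} {a c : ℝ}
    (hg : ∀ᶠ t in 𝓝 a, HasDerivAt g (g' t) t) (hg' : HasDerivAt g' c a)
    (hmax : IsLocalMax g a) : c ≤ 0 := by
  by_contra! hc
  have hderiv : deriv g =ᶠ[𝓝 a] g' := hg.mono fun t ht => ht.deriv
  have hsecond : deriv (deriv g) a = c := by rw [hderiv.deriv_eq, hg'.deriv]
  have hmin : IsLocalMin g a :=
    isLocalMin_of_deriv_deriv_pos (hsecond.symm ▸ hc) hmax.deriv_eq_zero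
      hg.self_of_nhds.continuousAt
  have hconst : g =ᶠ[𝓝 a] fun _ => g a := by
    filter_upwards [hmax, hmin] with t h₁ h₂ using le_antisymm h₁ h₂
  have hzero : deriv (deriv g) a = 0 := by
    rw [hconst.deriv.deriv_eq]
    simp
  linarith

section LineDerivatives

variable {E : Type*} [NormedAddCommGroup E] [NormedSpace ℝ E] {f : E → ℝ} {y : E}

lemma ContDiffAt.eventually_hasDerivAt_line (hf : ContDiffAt ℝ 2 f y) (e : E) :
    ∀ᶠ t : ℝ in 𝓝 0, HasDerivAt (fun t : ℝ => f (y + t • e)) (fderiv ℝ f (y + t • e) e) t := by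
  have hev : ∀ᶠ z in 𝓝 y, DifferentiableAt ℝ f z :=
    (hf.eventually (by simp)).mono fun z hz => hz.differentiableAt (by simp)
  have hcont : Tendsto (fun t : ℝ => y + t • e) (𝓝 0) (𝓝 y) := by
    have : Continuous fun t : ℝ => y + t • e := by fun_prop
    simpa using this.tendsto 0
  filter_upwards [hcont.eventually hev] with t ht
  have hline : HasDerivAt (fun t : ℝ => y + t • e) e t := by
    simpa using ((hasDerivAt_id t).smul_const e).const_add y
  exact ht.hasFDerivAt.comp_hasDerivAt t hline

lemma ContDiffAt.hasDerivAt_fderiv_line (hf : ContDiffAt ℝ 2 f y) (e : E) :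
    HasDerivAt (fun t : ℝ => fderiv ℝ f (y + t • e) e) (iteratedFDeriv ℝ 2 f y ![e, e]) 0 := by
  have hline : HasDerivAt (fun t : ℝ => y + t • e) e 0 := by
    simpa using ((hasDerivAt_id (0 : ℝ)).smul_const e).const_add y
  have hdiff : DifferentiableAt ℝ (fderiv ℝ f) y :=
    (hf.fderiv_right (m := 1) (by norm_num)).differentiableAt (by simp)
  have h : HasDerivAt (fun t : ℝ => fderiv ℝ f (y + t • e)) (fderiv ℝ (fderiv ℝ f) y e) 0 :=
    hdiff.hasFDerivAt.comp_hasDerivAt_of_eq 0 hline (by simp)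
  rw [iteratedFDeriv_two_apply]
  exact (ContinuousLinearMap.apply ℝ ℝ e).hasFDerivAt.comp_hasDerivAt 0 h

end LineDerivatives

lemma HarmonicOnE.neg {n : ℕ} {f : EuclideanSpace ℝ (Fin n) → ℝ}
    {U : Set (EuclideanSpace ℝ (Fin n))} (hf : HarmonicOnE f U) :
    HarmonicOnE (fun x => -f x) U := by
  refine ⟨hf.1.neg, fun x hx => ?_⟩
  have h := hf.2 x hx
  simp only [eLaplacian] at h ⊢
  change ∑ i : Fin n, iteratedFDeriv ℝ 2 (-f) x _ = 0
  simp [iteratedFDeriv_neg, h]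

/-- The weak maximum principle for the homogeneity defect `u (s • x) - s * u x` of a harmonic
function, perturbed by a strictly subharmonic quadratic: it has no interior local maximum. -/
lemma HarmonicOnE.not_isLocalMax_defect_add_sq {n : ℕ} (hn : 1 ≤ n)
    {u : EuclideanSpace ℝ (Fin n) → ℝ} (hu : HarmonicOnE u (ball 0 1)) {s ε : ℝ}
    (hε : 0 < ε) {x : EuclideanSpace ℝ (Fin n)} (hx : x ∈ ball 0 1) (hsx : s • x ∈ ball 0 1) :
    ¬ IsLocalMax (fun z => u (s • z) - s * u z + ε * ‖z‖ ^ 2) x := by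
  intro hmax
  have hC : ∀ z ∈ ball (0 : EuclideanSpace ℝ (Fin n)) 1, ContDiffAt ℝ 2 u z := fun z hz =>
    hu.1.contDiffAt (isOpen_ball.mem_nhds hz)
  have key : ∀ i : Fin n,
      s ^ 2 * iteratedFDeriv ℝ 2 u (s • x)
          ![EuclideanSpace.single i (1 : ℝ), EuclideanSpace.single i (1 : ℝ)]
        - s * iteratedFDeriv ℝ 2 u x
          ![EuclideanSpace.single i (1 : ℝ), EuclideanSpace.single i (1 : ℝ)] + ε * 2 ≤ 0 := by
    intro i
    set e : EuclideanSpace ℝ (Fin n) := EuclideanSpace.single i (1 : ℝ) with he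
    have hnorm : ‖e‖ = 1 := by simp [he]
    have hscale : iteratedFDeriv ℝ 2 u (s • x) ![s • e, s • e]
        = s ^ 2 * iteratedFDeriv ℝ 2 u (s • x) ![e, e] := by
      simp [iteratedFDeriv_two_apply]
      ring
    have hquad : ∀ t : ℝ, ‖x + t • e‖ ^ 2 = ‖x‖ ^ 2 + 2 * inner ℝ x e * t + t ^ 2 := by
      intro t
      rw [norm_add_sq_real, inner_smul_right, norm_smul, hnorm, mul_one, Real.norm_eq_abs, sq_abs]
      ring
    have hquad' : ∀ t : ℝ, HasDerivAt (fun t : ℝ => ‖x + t • e‖ ^ 2)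
        (2 * inner ℝ x e + 2 * t) t := by
      intro t
      simp_rw [hquad]
      exact ((((hasDerivAt_id' t).const_mul (2 * inner ℝ x e)).const_add (‖x‖ ^ 2)).add
        (hasDerivAt_pow 2 t)).congr_deriv (by simp)
    have hlin : HasDerivAt (fun t : ℝ => 2 * inner ℝ x e + 2 * t) 2 0 := by
      simpa using ((hasDerivAt_id (0 : ℝ)).const_mul 2).const_add (2 * inner ℝ x e)
    rw [← hscale]
    refine IsLocalMax.second_deriv_nonpos (a := 0)
      (g := fun t : ℝ => u (s • x + t • s • e) - s * u (x + t • e) + ε * ‖x + t • e‖ ^ 2)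
      (g' := fun t : ℝ => fderiv ℝ u (s • x + t • s • e) (s • e)
        - s * fderiv ℝ u (x + t • e) e + ε * (2 * inner ℝ x e + 2 * t)) ?_ ?_ ?_
    · filter_upwards [(hC _ hsx).eventually_hasDerivAt_line (s • e),
        (hC _ hx).eventually_hasDerivAt_line e] with t h₁ h₂
      exact (h₁.sub (h₂.const_mul s)).add ((hquad' t).const_mul ε)
    · exact (((hC _ hsx).hasDerivAt_fderiv_line (s • e)).sub
        (((hC _ hx).hasDerivAt_fderiv_line e).const_mul s)).add (hlin.const_mul ε)
    · have hcont : Tendsto (fun t : ℝ => x + t • e) (𝓝 0) (𝓝 x) := by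
        have : Continuous fun t : ℝ => x + t • e := by fun_prop
        simpa using this.tendsto 0
      filter_upwards [hcont.eventually hmax] with t ht
      simpa [smul_add, smul_comm t s e] using ht
  have hsum := Finset.sum_nonpos fun i (_ : i ∈ Finset.univ) => key i
  have h₁ := hu.2 _ hsx
  have h₂ := hu.2 _ hx
  simp only [eLaplacian] at h₁ h₂
  rw [Finset.sum_add_distrib, Finset.sum_sub_distrib, ← Finset.mul_sum, ← Finset.mul_sum,
    h₁, h₂] at hsum
  simp only [Finset.sum_const, Finset.card_univ, Fintype.card_fin, nsmul_eq_mul] at hsum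
  have hn' : (1 : ℝ) ≤ n := by exact_mod_cast hn
  nlinarith

lemma HarmonicOnE.defect_nonpos {n : ℕ} (hn : 1 ≤ n) {u : EuclideanSpace ℝ (Fin n) → ℝ}
    (hu : HarmonicOnE u (ball 0 1)) {s ρ : ℝ} (hs₀ : 0 < s) (hs₁ : s ≤ 1) (hρ₀ : 0 < ρ)
    (hρ₁ : ρ < 1)
    (hzero : ∀ x : EuclideanSpace ℝ (Fin n), ρ < ‖x‖ → ‖x‖ < 1 → u (s • x) = s * u x)
    {x : EuclideanSpace ℝ (Fin n)} (hx : x ∈ ball 0 1) :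
    u (s • x) ≤ s * u x := by
  by_contra! hpos
  have hmaps : ∀ z ∈ ball (0 : EuclideanSpace ℝ (Fin n)) 1, s • z ∈ ball 0 1 := by
    intro z hz
    rw [mem_ball_zero_iff] at hz ⊢
    rw [norm_smul, Real.norm_of_nonneg hs₀.le]
    nlinarith [norm_nonneg z]
  have hxρ : ‖x‖ ≤ ρ := by
    by_contra! h
    exact hpos.ne' (hzero x h (by simpa using hx))
  obtain ⟨r, hr, hr₁⟩ := exists_between hρ₁
  set ε := u (s • x) - s * u x with hε
  have hε₀ : 0 < ε := sub_pos.2 hpos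
  have hsub : closedBall (0 : EuclideanSpace ℝ (Fin n)) r ⊆ ball 0 1 :=
    closedBall_subset_ball hr₁
  have hcont : ContinuousOn (fun z => u (s • z) - s * u z + ε * ‖z‖ ^ 2)
      (closedBall (0 : EuclideanSpace ℝ (Fin n)) r) := by
    have h₁ : ContinuousOn u (closedBall 0 r) := hu.1.continuousOn.mono hsub
    have h₂ : ContinuousOn (fun z => u (s • z)) (closedBall 0 r) :=
      hu.1.continuousOn.comp (by fun_prop) fun z hz => hmaps z (hsub hz)
    exact (h₂.sub (h₁.const_mul s)).add (by fun_prop)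
  have hxr : x ∈ closedBall (0 : EuclideanSpace ℝ (Fin n)) r := by
    rw [mem_closedBall_zero_iff]
    linarith
  obtain ⟨y, hy, hmax⟩ := (isCompact_closedBall _ r).exists_isMaxOn ⟨x, hxr⟩ hcont
  have hyx : ε + ε * ‖x‖ ^ 2 ≤ u (s • y) - s * u y + ε * ‖y‖ ^ 2 := hmax hxr
  have hyr : ‖y‖ < r := by
    by_contra! h
    have hy₁ : ‖y‖ < 1 := by simpa using hsub hy
    rw [hzero y (hr.trans_le h) hy₁] at hyx
    nlinarith [mul_nonneg hε₀.le (sq_nonneg ‖x‖), norm_nonneg y,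
      mul_pos hε₀ (show 0 < 1 - ‖y‖ ^ 2 by nlinarith [norm_nonneg y])]
  exact hu.not_isLocalMax_defect_add_sq hn hε₀ (hsub hy) (hmaps _ (hsub hy))
    (hmax.isLocalMax (mem_of_superset (isOpen_ball.mem_nhds (by simpa using hyr))
      ball_subset_closedBall))

/-- Let `n ≥ 1` and let `u` be harmonic on `B₁ ⊂ ℝⁿ`.  Suppose
`u (t • x) = t * u x` whenever `t > 0`, `x ∈ B₁ \ closedBall 0 (1/2)`, and
`t • x ∈ B₁ \ closedBall 0 (1/2)`.  Then `u (t • x) = t * u x` for all `x ∈ B₁` and all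
`t ∈ (0, 1]`: positive homogeneity of degree one on the annulus propagates, by unique
continuation, to all of `B₁`. -/
theorem homogeneity_on_annulus_propagates
    {n : ℕ} (hn : 1 ≤ n) (u : EuclideanSpace ℝ (Fin n) → ℝ)
    (hharm : HarmonicOnE u (ball (0 : EuclideanSpace ℝ (Fin n)) 1))
    (hhom : ∀ t : ℝ, 0 < t →
      ∀ x ∈ ball (0 : EuclideanSpace ℝ (Fin n)) 1 \ closedBall 0 (1 / 2),
        t • x ∈ ball (0 : EuclideanSpace ℝ (Fin n)) 1 \ closedBall 0 (1 / 2) →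
          u (t • x) = t * u x) :
    ∀ x ∈ ball (0 : EuclideanSpace ℝ (Fin n)) 1, ∀ t ∈ Ioc (0 : ℝ) 1,
      u (t • x) = t * u x := by
  have hstep : ∀ s ∈ Ioo (1 / 2 : ℝ) 1, ∀ x ∈ ball (0 : EuclideanSpace ℝ (Fin n)) 1,
      u (s • x) = s * u x := by
    rintro s ⟨hs, hs₁⟩ x hx
    have hs₀ : 0 < s := by linarith
    have hρ₁ : 1 / (2 * s) < 1 := by
      rw [div_lt_one (by linarith)]
      linarith
    have hzero : ∀ z : EuclideanSpace ℝ (Fin n), 1 / (2 * s) < ‖z‖ → ‖z‖ < 1 →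
        u (s • z) = s * u z := by
      intro z hz hz₁
      rw [div_lt_iff₀ (by linarith)] at hz
      refine hhom s hs₀ z ?_ ?_ <;>
        simp only [Set.mem_sdiff, mem_ball_zero_iff, mem_closedBall_zero_iff, not_le, norm_smul,
          Real.norm_of_nonneg hs₀.le] <;>
        constructor <;> nlinarith [norm_nonneg z]
    refine le_antisymm (hharm.defect_nonpos hn hs₀ hs₁.le (by positivity) hρ₁ hzero hx) ?_
    have hneg := hharm.neg.defect_nonpos hn hs₀ hs₁.le (by positivity) hρ₁
      (fun z hz hz₁ => by rw [hzero z hz hz₁]; ring) hx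
    linarith
  have hpow : ∀ s ∈ Ioo (1 / 2 : ℝ) 1, ∀ k : ℕ, ∀ x ∈ ball (0 : EuclideanSpace ℝ (Fin n)) 1,
      u (s ^ k • x) = s ^ k * u x := by
    intro s hs k
    induction k with
    | zero => simp
    | succ k ih =>
      intro x hx
      have hsx : s • x ∈ ball (0 : EuclideanSpace ℝ (Fin n)) 1 := by
        rw [mem_ball_zero_iff] at hx ⊢
        rw [norm_smul, Real.norm_of_nonneg (by linarith [hs.1])]
        nlinarith [norm_nonneg x, hs.1, hs.2]
      rw [pow_succ, mul_smul, ih _ hsx, hstep s hs x hx, mul_assoc]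
  rintro x hx t ⟨ht₀, ht₁⟩
  rcases ht₁.eq_or_lt with rfl | ht₁
  · simp
  obtain ⟨k, hk⟩ := exists_pow_lt_of_lt_one ht₀ (by norm_num : (1 / 2 : ℝ) < 1)
  have hk₀ : k ≠ 0 := by
    rintro rfl
    simp at hk
    linarith
  have hroot : (t ^ (k : ℝ)⁻¹) ^ k = t := Real.rpow_inv_natCast_pow ht₀.le hk₀
  have hmem : t ^ (k : ℝ)⁻¹ ∈ Ioo (1 / 2 : ℝ) 1 := by
    refine ⟨lt_of_pow_lt_pow_left₀ k (by positivity) (hroot.symm ▸ hk),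
      Real.rpow_lt_one ht₀.le ht₁ (by positivity)⟩
  simpa [hroot] using hpow _ hmem k x hx
end

section
/- Let n ≥ 2 and let H := {x ∈ ℝ^n : x₁ > 0}. Suppose v : H̄ ∩ B_1 → ℝ is continuous, harmonic on H ∩ B_1, vanishes on ∂H ∩ B_1, and is positively homogeneous of degree one on H̄ ∩ B_1. Then there exists a ∈ ℝ such that v(x) = a·x₁ for all x ∈ H̄ ∩ B_1. -/
open Set Metric

/-- Second-order necessary condition for a local maximum, relative to a quadratic. -/
lemma deriv_deriv_le_of_isLocalMax_sub_quadratic {g : ℝ → ℝ} (hg : ContDiffAt ℝ 2 g 0)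
    {l c : ℝ} (hmax : IsLocalMax (fun t ↦ g t - (l * t + c * t ^ 2)) 0) :
    deriv (deriv g) 0 ≤ 2 * c := by
  set k : ℝ → ℝ := fun t ↦ g t - (l * t + c * t ^ 2) with hk
  have hq : ∀ t : ℝ, HasDerivAt (fun t : ℝ ↦ l * t + c * t ^ 2) (l + 2 * c * t) t := fun t ↦ by
    exact (((hasDerivAt_id' t).const_mul l).add ((hasDerivAt_pow 2 t).const_mul c)).congr_deriv
      (by norm_num; ring)
  have hev : deriv k =ᶠ[nhds 0] fun t ↦ deriv g t - (l + 2 * c * t) := by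
    filter_upwards [hg.eventually (by simp)] with t ht
    exact ((ht.differentiableAt two_ne_zero).hasDerivAt.sub (hq t)).deriv
  have hd : DifferentiableAt ℝ (deriv g) 0 :=
    ((hg.fderiv_right (m := 1) (by norm_num)).differentiableAt one_ne_zero).clm_apply
      (differentiableAt_const (1 : ℝ))
  have hlin : HasDerivAt (fun t : ℝ ↦ l + 2 * c * t) (2 * c) 0 := by
    simpa using ((hasDerivAt_id (0 : ℝ)).const_mul (2 * c)).const_add l
  have h2 : deriv (deriv k) 0 = deriv (deriv g) 0 - 2 * c := by
    rw [hev.deriv_eq]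
    exact (hd.hasDerivAt.sub hlin).deriv
  by_contra! hlt
  have hkc : ContinuousAt k 0 := hg.continuousAt.sub (hq 0).continuousAt
  have hmin : IsLocalMin k 0 :=
    isLocalMin_of_deriv_deriv_pos (by rw [h2]; linarith) hmax.deriv_eq_zero hkc
  have hconst : k =ᶠ[nhds 0] fun _ ↦ k 0 := by
    filter_upwards [hmax, hmin] with t h1 h2 using le_antisymm h1 h2
  have h0 : deriv k =ᶠ[nhds 0] fun _ ↦ 0 := by
    filter_upwards [hconst.eventuallyEq_nhds] with t ht
    rw [ht.deriv_eq, deriv_const]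
  rw [h0.deriv_eq, deriv_const] at h2
  linarith

section EuclideanSpace

variable {N : ℕ}

lemma iteratedFDeriv_two_eq_deriv_deriv_line {E : Type*} [NormedAddCommGroup E] [NormedSpace ℝ E]
    {f : E → ℝ} {q : E} (hf : ContDiffAt ℝ 2 f q) (e : E) :
    iteratedFDeriv ℝ 2 f q ![e, e] = deriv (deriv fun t : ℝ ↦ f (q + t • e)) 0 := by
  have hline : ∀ t : ℝ, HasDerivAt (fun t : ℝ ↦ q + t • e) e t := fun t ↦ by
    simpa using ((hasDerivAt_id t).smul_const e).const_add q
  have htend : Filter.Tendsto (fun t : ℝ ↦ q + t • e) (nhds 0) (nhds q) := by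
    simpa using (hline 0).continuousAt.tendsto
  have hev : (deriv fun t : ℝ ↦ f (q + t • e)) =ᶠ[nhds 0] fun t ↦ fderiv ℝ f (q + t • e) e := by
    filter_upwards [htend.eventually (hf.eventually (by simp))] with t ht
    exact ((ht.differentiableAt two_ne_zero).hasFDerivAt.comp_hasDerivAt t (hline t)).deriv
  have hd : DifferentiableAt ℝ (fderiv ℝ f) (q + (0 : ℝ) • e) := by
    rw [zero_smul, add_zero]
    exact (hf.fderiv_right (m := 1) (by norm_num)).differentiableAt one_ne_zero
  have h : HasDerivAt (fun t : ℝ ↦ fderiv ℝ f (q + t • e) e)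
      (fderiv ℝ (fderiv ℝ f) (q + (0 : ℝ) • e) e e) 0 := by
    have h1 : HasDerivAt (fun t : ℝ ↦ fderiv ℝ f (q + t • e))
        (fderiv ℝ (fderiv ℝ f) (q + (0 : ℝ) • e) e) 0 :=
      hd.hasFDerivAt.comp_hasDerivAt (0 : ℝ) (hline 0)
    exact (h1.clm_apply (hasDerivAt_const (0 : ℝ) e)).congr_deriv (by simp)
  rw [hev.deriv_eq, iteratedFDeriv_two_apply, h.deriv, zero_smul, add_zero]
  rfl

/-- If `f - P` has a local maximum at `q` and `P` is quadratic along the coordinate lines through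
`q`, the Laplacian of `f` at `q` is at most that of `P`. -/
lemma eLaplacian_le_of_isLocalMax_sub {f P : EuclideanSpace ℝ (Fin N) → ℝ}
    {q : EuclideanSpace ℝ (Fin N)} (hf : ContDiffAt ℝ 2 f q) (l c : Fin N → ℝ)
    (hP : ∀ i (t : ℝ), P (q + t • EuclideanSpace.single i (1 : ℝ)) = P q + l i * t + c i * t ^ 2)
    (hmax : IsLocalMax (fun x ↦ f x - P x) q) : eLaplacian f q ≤ 2 * ∑ i, c i := by
  rw [eLaplacian, Finset.mul_sum]
  refine Finset.sum_le_sum fun i _ ↦ ?_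
  set e := EuclideanSpace.single i (1 : ℝ)
  rw [iteratedFDeriv_two_eq_deriv_deriv_line hf]
  have hline : ContDiff ℝ 2 fun t : ℝ ↦ q + t • e := by fun_prop
  have htend : Filter.Tendsto (fun t : ℝ ↦ q + t • e) (nhds 0) (nhds q) := by
    simpa using (hline.continuous.tendsto 0)
  refine deriv_deriv_le_of_isLocalMax_sub_quadratic (l := l i) ?_ ?_
  · exact ContDiffAt.comp (0 : ℝ) (by simpa using hf) hline.contDiffAt
  · filter_upwards [htend.eventually hmax] with t ht
    have := hP i t
    simp only [e] at *
    simp only [zero_smul, add_zero]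
    linarith

lemma norm_add_single_sq (x : EuclideanSpace ℝ (Fin N)) (i : Fin N) (t : ℝ) :
    ‖x + t • EuclideanSpace.single i (1 : ℝ)‖ ^ 2 = ‖x‖ ^ 2 + 2 * x i * t + t ^ 2 := by
  rw [norm_add_sq_real, inner_smul_right, norm_smul]
  simp [EuclideanSpace.inner_single_right]
  ring

/-- Hopf's argument: a nonpositive harmonic function cannot vanish at a point `z` lying on the
boundary of a ball inside which it is negative near `z`. -/
lemma HarmonicOnE.false_of_touching_ball {w : EuclideanSpace ℝ (Fin N) → ℝ}
    {G : Set (EuclideanSpace ℝ (Fin N))} (hG : IsOpen G) (hw : HarmonicOnE w G)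
    (hle : ∀ x ∈ G, w x ≤ 0) {y z : EuclideanSpace ℝ (Fin N)} (hz : z ∈ G) (hwz : w z = 0)
    (hyz : y ≠ z) (hneg : ∀ x ∈ G, x ∈ ball y (dist z y) → w x < 0) : False := by
  set d := y - z with hd
  have hd0 : d ≠ 0 := sub_ne_zero.mpr hyz
  set R := ‖d‖ with hR
  have hR0 : 0 < R := norm_pos_iff.mpr hd0
  set a : ℝ := (N + 1) / R ^ 2 with ha
  have ha0 : 0 < a := by positivity
  have haR : a * R ^ 2 = N + 1 := by rw [ha]; field_simp
  obtain ⟨ρ₀, hρ₀, hball⟩ := Metric.nhds_basis_closedBall.mem_iff.mp (hG.mem_nhds hz)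
  set ρ := min ρ₀ (1 / (2 * a * R)) with hρdef
  have hρ : 0 < ρ := lt_min hρ₀ (by positivity)
  have hρa : a * (R * ρ) ≤ 1 / 2 := by
    have : ρ ≤ 1 / (2 * a * R) := min_le_right _ _
    rw [le_div_iff₀ (by positivity)] at this
    linarith
  have hsub : closedBall z ρ ⊆ G := (closedBall_subset_closedBall (min_le_left _ _)).trans hball
  set S : EuclideanSpace ℝ (Fin N) → ℝ := fun x ↦ inner ℝ d (x - z) with hS
  set h : EuclideanSpace ℝ (Fin N) → ℝ := fun x ↦ S x + a * S x ^ 2 - ‖x - z‖ ^ 2 with hh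
  have hScont : Continuous S := by fun_prop
  have hhcont : Continuous h := by fun_prop
  have hSle : ∀ x ∈ closedBall z ρ, |S x| ≤ R * ρ := fun x hx ↦
    (abs_real_inner_le_norm _ _).trans (by
      rw [mem_closedBall, dist_eq_norm] at hx
      gcongr)
  have haS : ∀ x ∈ closedBall z ρ, |a * S x| ≤ 1 / 2 := fun x hx ↦ by
    rw [abs_mul, abs_of_pos ha0]
    exact (mul_le_mul_of_nonneg_left (hSle x hx) ha0.le).trans hρa
  have hwcont : ContinuousOn w (closedBall z ρ) := hw.1.continuousOn.mono hsub
  have hTneg : ∀ x ∈ sphere z ρ ∩ {x | 0 ≤ h x}, w x < 0 := by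
    rintro x ⟨hx, hx0 : 0 ≤ h x⟩
    have hxc := sphere_subset_closedBall hx
    refine hneg x (hsub hxc) ?_
    have h1 := abs_le.mp (haS x hxc)
    have hxz : ‖x - z‖ = ρ := by rwa [mem_sphere, dist_eq_norm] at hx
    have hx0' : ρ ^ 2 ≤ S x * (1 + a * S x) := by
      have : 0 ≤ S x + a * S x ^ 2 - ‖x - z‖ ^ 2 := hx0
      rw [hxz] at this
      linarith
    have hSpos : 0 < S x := by
      by_contra! hneg'
      nlinarith [pow_pos hρ 2]
    have hlt : ρ ^ 2 < 2 * S x := by nlinarith [pow_pos hρ 2]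
    have hexp : ‖x - y‖ ^ 2 = ‖x - z‖ ^ 2 - 2 * S x + R ^ 2 := by
      have : x - y = (x - z) - d := by rw [hd]; abel
      rw [this, norm_sub_sq_real, real_inner_comm]
    rw [mem_ball, dist_eq_norm, dist_comm, dist_eq_norm]
    refine lt_of_pow_lt_pow_left₀ 2 (norm_nonneg _) ?_
    rw [hexp, hxz]
    linarith
  have hT : IsCompact (sphere z ρ ∩ {x | 0 ≤ h x}) :=
    (isCompact_sphere z ρ).inter_right (isClosed_le continuous_const hhcont)
  obtain ⟨c, hc, hcle⟩ : ∃ c > 0, ∀ x ∈ sphere z ρ ∩ {x | 0 ≤ h x}, w x ≤ -c := by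
    rcases (sphere z ρ ∩ {x | 0 ≤ h x}).eq_empty_or_nonempty with he | hne
    · exact ⟨1, one_pos, by simp [he]⟩
    · obtain ⟨m, hm, hmax⟩ := hT.exists_isMaxOn hne
        (hwcont.mono (inter_subset_left.trans sphere_subset_closedBall))
      exact ⟨-w m, by linarith [hTneg m hm], fun x hx ↦ by simpa using hmax hx⟩
  set ε := c / (2 * (R * ρ)) with hε
  have hε0 : 0 < ε := by positivity
  have hεc : ε * (R * ρ) = c / 2 := by rw [hε]; field_simp
  obtain ⟨q, hq, hqmax⟩ := (isCompact_closedBall z ρ).exists_isMaxOn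
    ⟨z, mem_closedBall_self hρ.le⟩ (f := fun x ↦ w x - -(ε * h x)) (by fun_prop)
  have hq0 : 0 ≤ w q - -(ε * h q) := by
    have := hqmax (mem_closedBall_self hρ.le)
    simpa [hwz, hh, hS] using this
  have hqs : q ∈ ball z ρ := by
    refine lt_of_le_of_ne (mem_closedBall.mp hq) fun hqs ↦ ?_
    rcases le_or_gt 0 (h q) with hhq | hhq
    · have h1 := hcle q ⟨hqs, hhq⟩
      have h2 := abs_le.mp (hSle q hq)
      have h3 := abs_le.mp (haS q hq)
      have h4 : h q ≤ 3 / 2 * (R * ρ) := by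
        simp only [hh]
        nlinarith [sq_nonneg ‖q - z‖, mul_pos hR0 hρ, abs_nonneg (S q),
          mul_le_mul (hSle q hq) (haS q hq) (abs_nonneg _) (mul_pos hR0 hρ).le,
          le_abs_self (S q * (a * S q)), abs_mul (S q) (a * S q)]
      nlinarith [mul_le_mul_of_nonneg_left h4 hε0.le]
    · nlinarith [hle q (hsub hq)]
  have hloc : IsLocalMax (fun x ↦ w x - -(ε * h x)) q :=
    hqmax.isLocalMax (Filter.mem_of_superset (isOpen_ball.mem_nhds hqs) ball_subset_closedBall)
  have hlap := eLaplacian_le_of_isLocalMax_sub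
    (hw.1.contDiffAt (hG.mem_nhds (hsub hq)))
    (fun i ↦ -ε * (d i + 2 * a * S q * d i - 2 * (q - z) i)) (fun i ↦ -ε * (a * d i ^ 2 - 1))
    (P := fun x ↦ -(ε * h x)) (fun i t ↦ by
      have hn := norm_add_single_sq (q - z) i t
      have hadd : q + t • EuclideanSpace.single i (1 : ℝ) - z =
        q - z + t • EuclideanSpace.single i (1 : ℝ) := by abel
      have hs : S (q + t • EuclideanSpace.single i (1 : ℝ)) = S q + t * d i := by
        simp only [hS, hadd]
        rw [inner_add_right, inner_smul_right, EuclideanSpace.inner_single_right]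
        simp
      simp only [hh, hs, hadd, hn]
      ring) hloc
  rw [hw.2 q (hsub hq), ← Finset.mul_sum, Finset.sum_sub_distrib, ← Finset.mul_sum,
    ← EuclideanSpace.real_norm_sq_eq, ← hR, haR] at hlap
  simp at hlap
  linarith

/-- The strong maximum principle for harmonic functions. -/
lemma HarmonicOnE.eq_zero_of_nonpos {w : EuclideanSpace ℝ (Fin N) → ℝ}
    {G : Set (EuclideanSpace ℝ (Fin N))} (hG : IsOpen G) (hconn : IsPreconnected G)
    (hw : HarmonicOnE w G) (hle : ∀ x ∈ G, w x ≤ 0) {p : EuclideanSpace ℝ (Fin N)} (hp : p ∈ G)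
    (hwp : w p = 0) : ∀ x ∈ G, w x = 0 := by
  have hcont := hw.1.continuousOn
  have hU : IsOpen (G ∩ w ⁻¹' Iio 0) := hcont.isOpen_inter_preimage hG isOpen_Iio
  have hlocal : ∀ z ∈ G, w z = 0 → z ∈ interior {x | x ∈ G ∧ w x = 0} := by
    intro z hz hwz
    obtain ⟨s, hs, hball⟩ := Metric.isOpen_iff.mp hG z hz
    rw [mem_interior_iff_mem_nhds, Metric.mem_nhds_iff]
    refine ⟨s / 3, by positivity, fun y hy ↦ ?_⟩
    rw [mem_ball] at hy
    have hyG : y ∈ G := hball (by rw [mem_ball]; linarith)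
    refine ⟨hyG, ?_⟩
    by_contra hwy
    have hsubG : closedBall z (2 * s / 3) ⊆ G :=
      (closedBall_subset_ball (by linarith)).trans hball
    have hZ : IsCompact (closedBall z (2 * s / 3) ∩ w ⁻¹' {0}) :=
      (isCompact_closedBall _ _).of_isClosed_subset
        ((hcont.mono hsubG).preimage_isClosed_of_isClosed isClosed_closedBall isClosed_singleton)
        inter_subset_left
    have hzZ : z ∈ closedBall z (2 * s / 3) ∩ w ⁻¹' {0} :=
      ⟨mem_closedBall_self (by positivity), hwz⟩
    obtain ⟨z₁, ⟨hz₁, hwz₁⟩, hdist⟩ := hZ.exists_infDist_eq_dist ⟨z, hzZ⟩ y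
    have hlt : dist y z₁ < s / 3 := hdist ▸ (infDist_le_dist_of_mem hzZ).trans_lt hy
    refine hw.false_of_touching_ball hG hle (hsubG hz₁) hwz₁ (y := y) ?_ fun x hx hxb ↦ ?_
    · rintro rfl
      exact hwy hwz₁
    · refine lt_of_le_of_ne (hle x hx) fun hwx ↦ ?_
      rw [mem_ball, dist_comm z₁] at hxb
      have hxZ : x ∈ closedBall z (2 * s / 3) ∩ w ⁻¹' {0} :=
        ⟨by rw [mem_closedBall]; linarith [dist_triangle x y z], hwx⟩
      have := infDist_le_dist_of_mem hxZ (x := y)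
      rw [hdist, dist_comm y x] at this
      linarith
  have hsub : G ⊆ interior {x | x ∈ G ∧ w x = 0} := by
    refine hconn.subset_left_of_subset_union isOpen_interior hU ?_ (fun x hx ↦ ?_)
      ⟨p, hp, hlocal p hp hwp⟩
    · rw [Set.disjoint_left]
      intro x hx hx'
      exact (ne_of_lt hx'.2) (interior_subset hx).2
    · rcases (hle x hx).lt_or_eq with h | h
      · exact Or.inr ⟨hx, h⟩
      · exact Or.inl (hlocal x hx h)
  exact fun x hx ↦ (interior_subset (hsub hx)).2

lemma HarmonicOnE.sub_clm {f : EuclideanSpace ℝ (Fin N) → ℝ}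
    {G : Set (EuclideanSpace ℝ (Fin N))} (hG : IsOpen G) (hf : HarmonicOnE f G)
    (L : EuclideanSpace ℝ (Fin N) →L[ℝ] ℝ) : HarmonicOnE (fun x ↦ f x - L x) G := by
  refine ⟨hf.1.sub L.contDiff.contDiffOn, fun x hx ↦ ?_⟩
  have hL : iteratedFDeriv ℝ 2 L x = 0 := by
    ext m
    have : fderiv ℝ (L : EuclideanSpace ℝ (Fin N) → ℝ) = fun _ ↦ L := by ext1 x; exact L.fderiv
    rw [iteratedFDeriv_two_apply, this]
    simp
  rw [← hf.2 x hx]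
  simp only [eLaplacian]
  rw [fun_iteratedFDeriv_sub_apply (hf.1.contDiffAt (hG.mem_nhds hx)) L.contDiff.contDiffAt, hL,
    sub_zero]

end EuclideanSpace

section HalfSpace

variable {n : ℕ}

/-- The part of the unit ball of `ℝⁿ⁺²` in the closed half-space `x₀ ≥ 0`. -/
abbrev halfBall (n : ℕ) : Set (EuclideanSpace ℝ (Fin (n + 2))) := {x | 0 ≤ x 0} ∩ ball 0 1

lemma eq_mul_of_homogeneous {w : EuclideanSpace ℝ (Fin (n + 2)) → ℝ}
    (hhom : ∀ x ∈ halfBall n, ∀ t ∈ Ioc (0 : ℝ) 1, t • x ∈ halfBall n → w (t • x) = t * w x)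
    {x : EuclideanSpace ℝ (Fin (n + 2))} {t : ℝ} (hx : x ∈ halfBall n) (ht : 0 < t)
    (htx : t • x ∈ halfBall n) : w (t • x) = t * w x := by
  rcases le_total t 1 with h | h
  · exact hhom x hx t ⟨ht, h⟩ htx
  · have hinv : t⁻¹ • t • x = x := inv_smul_smul₀ ht.ne' x
    have := hhom (t • x) htx t⁻¹ ⟨inv_pos.mpr ht, inv_le_one_of_one_le₀ h⟩ (by rwa [hinv])
    rw [hinv] at this
    rw [this]
    field_simp

lemma half_inv_norm_smul_mem {x : EuclideanSpace ℝ (Fin (n + 2))} (hx0 : 0 ≤ x 0) (hx : x ≠ 0) :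
    ‖(2 * ‖x‖)⁻¹ • x‖ = 1 / 2 ∧ (2 * ‖x‖)⁻¹ • x ∈ halfBall n := by
  have hpos : 0 < ‖x‖ := norm_pos_iff.mpr hx
  have hn : ‖(2 * ‖x‖)⁻¹ • x‖ = 1 / 2 := by
    rw [norm_smul, Real.norm_of_nonneg (by positivity)]
    field_simp
  refine ⟨hn, ?_, by rw [mem_ball_zero_iff, hn]; norm_num⟩
  simp only [mem_ofPred_eq, PiLp.smul_apply, smul_eq_mul]
  positivity

/-- A maximum principle on the thin wedge `{2 (n + 3) x₀² < ‖x‖²}` for homogeneous functions. -/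
lemma nonpos_of_nonpos_on_cone {w : EuclideanSpace ℝ (Fin (n + 2)) → ℝ}
    (hcont : ContinuousOn w (halfBall n))
    (hharm : HarmonicOnE w ({x : EuclideanSpace ℝ (Fin (n + 2)) | 0 < x 0} ∩ ball 0 1))
    (hbdry : ∀ x ∈ ball (0 : EuclideanSpace ℝ (Fin (n + 2))) 1, x 0 = 0 → w x = 0)
    (hhom : ∀ x ∈ halfBall n, ∀ t ∈ Ioc (0 : ℝ) 1, t • x ∈ halfBall n → w (t • x) = t * w x)
    (hcone : ∀ x ∈ halfBall n, ‖x‖ ^ 2 ≤ 2 * (n + 3) * x 0 ^ 2 → w x ≤ 0) :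
    ∀ x ∈ halfBall n, w x ≤ 0 := by
  intro x hx
  by_contra! hwx
  have hG : IsOpen ({x : EuclideanSpace ℝ (Fin (n + 2)) | 0 < x 0} ∩ ball 0 1) :=
    (isOpen_lt continuous_const (by fun_prop)).inter isOpen_ball
  have hx0 : x ≠ 0 := by
    rintro rfl
    rw [hbdry 0 (by simp) (by simp)] at hwx
    exact hwx.false
  obtain ⟨hyn, hy⟩ := half_inv_norm_smul_mem hx.1 hx0
  have hwy : 0 < w ((2 * ‖x‖)⁻¹ • x) := by
    rw [eq_mul_of_homogeneous hhom hx (by positivity) hy]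
    positivity
  set y := (2 * ‖x‖)⁻¹ • x
  set D : Set (EuclideanSpace ℝ (Fin (n + 2))) :=
    closedBall 0 (1 / 2) ∩ ({x | 0 ≤ x 0} ∩ {x | 2 * (n + 3) * x 0 ^ 2 ≤ ‖x‖ ^ 2}) with hD
  have hDc : IsCompact D := (isCompact_closedBall _ _).inter_right
    ((isClosed_le continuous_const (by fun_prop)).inter (isClosed_le (by fun_prop) (by fun_prop)))
  have hDsub : D ⊆ halfBall n := fun z hz ↦
    ⟨hz.2.1, closedBall_subset_ball (by norm_num) hz.1⟩
  have hyD : y ∈ D := by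
    refine ⟨by rw [mem_closedBall_zero_iff, hyn], hy.1, ?_⟩
    rw [mem_ofPred_eq]
    by_contra! hlt
    exact absurd (hcone y hy hlt.le) (not_le.mpr hwy)
  obtain ⟨m, -, hm⟩ := hDc.exists_isMaxOn ⟨y, hyD⟩ (hcont.mono hDsub)
  set C := w m
  have hC : ∀ z ∈ D, w z ≤ C := isMaxOn_iff.mp hm
  have hCy := hC y hyD
  set δ : ℝ := 8 * C + 8 with hδ
  have hδ0 : 0 < δ := by linarith
  set P : EuclideanSpace ℝ (Fin (n + 2)) → ℝ := fun z ↦ δ * (‖z‖ ^ 2 - (n + 3) * z 0 ^ 2) with hP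
  obtain ⟨q, hq, hqmax⟩ := hDc.exists_isMaxOn ⟨y, hyD⟩ (f := fun z ↦ w z - P z)
    ((hcont.mono hDsub).sub (by fun_prop))
  have hqpos : 0 < w q - P q := by
    set t := w y / δ with ht
    have ht0 : 0 < t := by positivity
    have ht1 : t ≤ 1 := by rw [ht, div_le_one hδ0]; linarith
    have htδ : δ * t = w y := by rw [ht]; field_simp
    have hnorm : ‖t • y‖ = t / 2 := by
      rw [norm_smul, hyn, Real.norm_of_nonneg ht0.le]; ring
    have htD : t • y ∈ D := by
      refine ⟨by rw [mem_closedBall_zero_iff, hnorm]; linarith, ?_, ?_⟩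
      · have : 0 ≤ y 0 := hy.1
        simp only [mem_ofPred_eq, PiLp.smul_apply, smul_eq_mul]
        positivity
      · have := hyD.2.2
        simp only [mem_ofPred_eq, norm_smul, PiLp.smul_apply, smul_eq_mul, mul_pow,
          Real.norm_eq_abs, sq_abs] at this ⊢
        nlinarith [sq_nonneg t]
    have h1 := hqmax htD
    simp only [mem_ofPred_eq] at h1
    refine lt_of_lt_of_le ?_ h1
    rw [eq_mul_of_homogeneous hhom hy ht0 (hDsub htD)]
    have hPle : P (t • y) ≤ δ * (t / 2) ^ 2 := by
      simp only [hP, hnorm]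
      gcongr
      have : 0 ≤ ((n : ℝ) + 3) * (t • y) 0 ^ 2 := by positivity
      linarith
    nlinarith [mul_pos ht0 hwy]
  have hqh := hDsub hq
  have hPq : δ * (‖q‖ ^ 2 / 2) ≤ P q := by
    simp only [hP]
    gcongr
    linarith [show 2 * ((n : ℝ) + 3) * q 0 ^ 2 ≤ ‖q‖ ^ 2 from hq.2.2]
  have hwq : 0 < w q := by nlinarith [sq_nonneg ‖q‖]
  have hq0 : 0 < q 0 := lt_of_le_of_ne hq.2.1 fun h ↦ by
    rw [hbdry q hqh.2 h.symm] at hwq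
    exact hwq.false
  have hqn : ‖q‖ < 1 / 2 := lt_of_le_of_ne (mem_closedBall_zero_iff.mp hq.1) fun h ↦ by
    rw [h] at hPq
    linarith [hC q hq]
  have hqw : 2 * ((n : ℝ) + 3) * q 0 ^ 2 < ‖q‖ ^ 2 := by
    by_contra! h
    linarith [hcone q hqh h]
  have hnhds : D ∈ nhds q := by
    have hopen : IsOpen (ball (0 : EuclideanSpace ℝ (Fin (n + 2))) (1 / 2) ∩
        ({x | 0 < x 0} ∩ {x | 2 * (n + 3) * x 0 ^ 2 < ‖x‖ ^ 2})) :=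
      isOpen_ball.inter ((isOpen_lt continuous_const (by fun_prop)).inter
        (isOpen_lt (by fun_prop) (by fun_prop)))
    refine Filter.mem_of_superset (hopen.mem_nhds ⟨mem_ball_zero_iff.mpr hqn, hq0, hqw⟩) ?_
    exact fun z hz ↦ ⟨ball_subset_closedBall hz.1, le_of_lt (mem_ofPred.mp hz.2.1),
      le_of_lt (mem_ofPred.mp hz.2.2)⟩
  have hlap := eLaplacian_le_of_isLocalMax_sub
    (hharm.1.contDiffAt (hG.mem_nhds ⟨hq0, hqh.2⟩))
    (fun i ↦ δ * (2 * q i - (n + 3) * (if i = 0 then 2 * q 0 else 0)))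
    (fun i ↦ δ * (1 - (n + 3) * (if i = 0 then 1 else 0))) (P := P) (fun i t ↦ by
      simp only [hP, norm_add_single_sq]
      by_cases hi : i = 0
      · subst hi
        simp
        ring
      · simp [hi, Ne.symm hi]
        ring) (hqmax.isLocalMax hnhds)
  rw [hharm.2 q ⟨hq0, hqh.2⟩, ← Finset.mul_sum, Finset.sum_sub_distrib, ← Finset.mul_sum] at hlap
  simp at hlap
  linarith

end HalfSpace

/-- Let the dimension be `n + 2 ≥ 2` and let `H := {x : x₁ > 0}` be the open
half-space.  Suppose `v : H̄ ∩ B₁ → ℝ` is continuous, harmonic on `H ∩ B₁`, vanishes on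
`∂H ∩ B₁`, and is positively homogeneous of degree one on `H̄ ∩ B₁`.  Then there is `a ∈ ℝ`
with `v x = a * x₁` on `H̄ ∩ B₁`. -/
theorem halfspace_homogeneous_harmonic_vanishing_boundary
    (n : ℕ) (v : EuclideanSpace ℝ (Fin (n + 2)) → ℝ)
    (hcont : ContinuousOn v
      ({x : EuclideanSpace ℝ (Fin (n + 2)) | 0 ≤ x 0} ∩ ball 0 1))
    (hharm : HarmonicOnE v
      ({x : EuclideanSpace ℝ (Fin (n + 2)) | 0 < x 0} ∩ ball 0 1))
    (hbdry : ∀ x ∈ ball (0 : EuclideanSpace ℝ (Fin (n + 2))) 1, x 0 = 0 → v x = 0)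
    (hhom : ∀ x ∈ ({x : EuclideanSpace ℝ (Fin (n + 2)) | 0 ≤ x 0} ∩ ball 0 1),
      ∀ t ∈ Ioc (0 : ℝ) 1,
        t • x ∈ ({x : EuclideanSpace ℝ (Fin (n + 2)) | 0 ≤ x 0} ∩ ball 0 1) →
          v (t • x) = t * v x) :
    ∃ a : ℝ, ∀ x ∈ ({x : EuclideanSpace ℝ (Fin (n + 2)) | 0 ≤ x 0} ∩ ball 0 1),
      v x = a * x 0 := by
  set K : Set (EuclideanSpace ℝ (Fin (n + 2))) :=
    sphere 0 (1 / 2) ∩ ({x | 0 ≤ x 0} ∩ {x | ‖x‖ ^ 2 ≤ 2 * (n + 3) * x 0 ^ 2}) with hK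
  have hKc : IsCompact K := (isCompact_sphere _ _).inter_right
    ((isClosed_le continuous_const (by fun_prop)).inter (isClosed_le (by fun_prop) (by fun_prop)))
  have hKpos : ∀ x ∈ K, 0 < x 0 := fun x hx ↦ lt_of_le_of_ne hx.2.1 fun h ↦ by
    have h1 : ‖x‖ ^ 2 ≤ 2 * ((n : ℝ) + 3) * x 0 ^ 2 := hx.2.2
    rw [← h, mem_sphere_zero_iff_norm.mp hx.1] at h1
    norm_num at h1
  have hKsub : K ⊆ {x : EuclideanSpace ℝ (Fin (n + 2)) | 0 ≤ x 0} ∩ ball 0 1 := fun x hx ↦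
    ⟨hx.2.1, closedBall_subset_ball (by norm_num) (sphere_subset_closedBall hx.1)⟩
  have hKne : K.Nonempty := by
    refine ⟨EuclideanSpace.single 0 (1 / 2), ?_, ?_, ?_⟩
    · simp
    · simp
    · simp
      have : (0 : ℝ) ≤ n := n.cast_nonneg
      linarith
  obtain ⟨p, hp, hpmax⟩ := hKc.exists_isMaxOn hKne (f := fun x ↦ v x / x 0)
    ((hcont.mono hKsub).div (by fun_prop) fun x hx ↦ (hKpos x hx).ne')
  set M := v p / p 0 with hM
  have hG : IsOpen ({x : EuclideanSpace ℝ (Fin (n + 2)) | 0 < x 0} ∩ ball 0 1) :=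
    (isOpen_lt continuous_const (by fun_prop)).inter isOpen_ball
  set L : EuclideanSpace ℝ (Fin (n + 2)) →L[ℝ] ℝ := M • EuclideanSpace.proj 0
  have hL : ∀ x, L x = M * x 0 := fun x ↦ rfl
  have hwhom : ∀ x ∈ ({x : EuclideanSpace ℝ (Fin (n + 2)) | 0 ≤ x 0} ∩ ball 0 1),
      ∀ t ∈ Ioc (0 : ℝ) 1,
        t • x ∈ ({x : EuclideanSpace ℝ (Fin (n + 2)) | 0 ≤ x 0} ∩ ball 0 1) →
          v (t • x) - L (t • x) = t * (v x - L x) := fun x hx t ht htx ↦ by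
    rw [hhom x hx t ht htx, map_smul, smul_eq_mul]
    ring
  have hwbdry : ∀ x ∈ ball (0 : EuclideanSpace ℝ (Fin (n + 2))) 1, x 0 = 0 → v x - L x = 0 :=
    fun x hx hx0 ↦ by rw [hbdry x hx hx0, hL, hx0]; ring
  have hwharm := hharm.sub_clm hG L
  have hle := nonpos_of_nonpos_on_cone (hcont.sub L.continuous.continuousOn) hwharm hwbdry hwhom
    fun x hx hxc ↦ by
      by_cases hx0 : x = 0
      · subst hx0
        exact (hwbdry 0 (by simp) (by simp)).le
      have hpos : 0 < ‖x‖ := norm_pos_iff.mpr hx0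
      obtain ⟨hyn, hy⟩ := half_inv_norm_smul_mem hx.1 hx0
      have hyK : (2 * ‖x‖)⁻¹ • x ∈ K := by
        refine ⟨mem_sphere_zero_iff_norm.mpr hyn, hy.1, ?_⟩
        simp only [mem_ofPred_eq, norm_smul, PiLp.smul_apply, smul_eq_mul, mul_pow,
          Real.norm_eq_abs, sq_abs]
        nlinarith [sq_nonneg (2 * ‖x‖)⁻¹]
      have h1 : v ((2 * ‖x‖)⁻¹ • x) / ((2 * ‖x‖)⁻¹ • x) 0 ≤ M := hpmax hyK
      rw [div_le_iff₀ (hKpos _ hyK), ← hL, ← sub_nonpos,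
        eq_mul_of_homogeneous (w := fun x ↦ v x - L x) hwhom hx (by positivity) hy] at h1
      exact nonpos_of_mul_nonpos_right h1 (by positivity)
  have hconn : IsPreconnected ({x : EuclideanSpace ℝ (Fin (n + 2)) | 0 < x 0} ∩ ball 0 1) := by
    refine Convex.isPreconnected (Convex.inter ?_ (convex_ball _ _))
    exact convex_halfSpace_gt (f := fun x : EuclideanSpace ℝ (Fin (n + 2)) ↦ x 0)
      (EuclideanSpace.proj (𝕜 := ℝ) 0).toLinearMap.isLinear 0
  have hzero := hwharm.eq_zero_of_nonpos hG hconn (fun x hx ↦ hle x ⟨le_of_lt (mem_ofPred.mp hx.1), hx.2⟩)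
    (p := p) ⟨hKpos p hp, (hKsub hp).2⟩ (by
      rw [hL, hM, div_mul_cancel₀ _ (hKpos p hp).ne', sub_self])
  refine ⟨M, fun x hx ↦ ?_⟩
  rw [← hL, ← sub_eq_zero]
  rcases (show (0 : ℝ) ≤ x 0 from hx.1).eq_or_lt with h | h
  · exact hwbdry x hx.2 h.symm
  · exact hzero x ⟨h, hx.2⟩
end

section
/- Let n ≥ 2 and let H := {x ∈ ℝ^n : x₁ > 0}. Suppose v : H̄ ∩ B_1 → ℝ is harmonic on H ∩ B_1, is C¹ up to the boundary (i.e. v and its gradient extend continuously to H̄ ∩ B_1), and is positively homogeneous of degree one on H̄ ∩ B_1. Then there is a linear map ℓ : ℝ^n → ℝ such that v(x) = ℓ(x) for all x ∈ H̄ ∩ B_1. -/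
open Set Metric

open Filter Topology

/-- Let the dimension be `n + 2 ≥ 2` and let `H := {x : x₁ > 0}` be the open
half-space.  Suppose `v : H̄ ∩ B₁ → ℝ` is harmonic on `H ∩ B₁`, is `C¹` up to the boundary
(i.e. `v` and its gradient extend continuously to `H̄ ∩ B₁`, the latter witnessed by `g`), and
is positively homogeneous of degree one on `H̄ ∩ B₁`.  Then there is a linear map
`ℓ : ℝ^{n+2} → ℝ` with `v = ℓ` on `H̄ ∩ B₁`. -/
theorem halfspace_C1_homogeneous_harmonic_is_linear
    (n : ℕ) (v : EuclideanSpace ℝ (Fin (n + 2)) → ℝ)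
    (g : EuclideanSpace ℝ (Fin (n + 2)) → (EuclideanSpace ℝ (Fin (n + 2)) →L[ℝ] ℝ))
    (hcont : ContinuousOn v
      ({x : EuclideanSpace ℝ (Fin (n + 2)) | 0 ≤ x 0} ∩ ball 0 1))
    (hgcont : ContinuousOn g
      ({x : EuclideanSpace ℝ (Fin (n + 2)) | 0 ≤ x 0} ∩ ball 0 1))
    (hgderiv : ∀ x ∈ ({x : EuclideanSpace ℝ (Fin (n + 2)) | 0 < x 0} ∩ ball 0 1),
      HasFDerivAt v (g x) x)
    (hharm : HarmonicOnE v
      ({x : EuclideanSpace ℝ (Fin (n + 2)) | 0 < x 0} ∩ ball 0 1))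
    (hhom : ∀ x ∈ ({x : EuclideanSpace ℝ (Fin (n + 2)) | 0 ≤ x 0} ∩ ball 0 1),
      ∀ t ∈ Ioc (0 : ℝ) 1,
        t • x ∈ ({x : EuclideanSpace ℝ (Fin (n + 2)) | 0 ≤ x 0} ∩ ball 0 1) →
          v (t • x) = t * v x) :
    ∃ ℓ : EuclideanSpace ℝ (Fin (n + 2)) →ₗ[ℝ] ℝ,
      ∀ x ∈ ({x : EuclideanSpace ℝ (Fin (n + 2)) | 0 ≤ x 0} ∩ ball 0 1), v x = ℓ x := by
  have hsub : ({x : EuclideanSpace ℝ (Fin (n + 2)) | 0 < x 0} ∩ ball 0 1) ⊆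
      ({x : EuclideanSpace ℝ (Fin (n + 2)) | 0 ≤ x 0} ∩ ball 0 1) :=
    inter_subset_inter_left _ (ofPred_subset_ofPred.2 fun x hx => le_of_lt hx)
  have euler : ∀ x ∈ ({x : EuclideanSpace ℝ (Fin (n + 2)) | 0 < x 0} ∩ ball 0 1),
      ∀ t ∈ Ioo (0 : ℝ) 1, g (t • x) x = v x := by
    rintro x ⟨hx0, hx1⟩ t ht
    have hmem : ∀ s ∈ Ioo (0 : ℝ) 1,
        s • x ∈ ({x : EuclideanSpace ℝ (Fin (n + 2)) | 0 < x 0} ∩ ball 0 1) := by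
      intro s hs
      refine ⟨?_, (convex_ball (0 : EuclideanSpace ℝ (Fin (n + 2))) 1).smul_mem_of_zero_mem
        (mem_ball_self one_pos) hx1 ⟨hs.1.le, hs.2.le⟩⟩
      simpa using mul_pos hs.1 hx0
    have hray : HasDerivAt (fun s : ℝ => s • x) x t := by
      simpa using (hasDerivAt_id t).smul_const x
    have hcomp : HasDerivAt (fun s : ℝ => v (s • x)) (g (t • x) x) t :=
      (hgderiv _ (hmem t ht)).comp_hasDerivAt t hray
    have hlin : HasDerivAt (fun s : ℝ => s * v x) (v x) t := by
      simpa using (hasDerivAt_id t).mul_const (v x)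
    refine hcomp.unique (hlin.congr_of_eventuallyEq ?_)
    filter_upwards [Ioo_mem_nhds ht.1 ht.2] with s hs
    exact hhom x (hsub ⟨hx0, hx1⟩) s ⟨hs.1, hs.2.le⟩ (hsub (hmem s hs))
  have interior_eq : EqOn v (g 0)
      ({x : EuclideanSpace ℝ (Fin (n + 2)) | 0 < x 0} ∩ ball 0 1) := by
    rintro x ⟨hx0, hx1⟩
    have hray : Tendsto (fun t : ℝ => t • x) (𝓝[Ioo 0 1] 0)
        (𝓝[{x : EuclideanSpace ℝ (Fin (n + 2)) | 0 ≤ x 0} ∩ ball 0 1] 0) := by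
      refine tendsto_nhdsWithin_iff.2 ⟨?_, ?_⟩
      · have : Continuous fun t : ℝ => t • x := by fun_prop
        simpa using (this.tendsto 0).mono_left nhdsWithin_le_nhds
      · filter_upwards [self_mem_nhdsWithin] with t ht
        refine ⟨?_, (convex_ball (0 : EuclideanSpace ℝ (Fin (n + 2))) 1).smul_mem_of_zero_mem
          (mem_ball_self one_pos) hx1 ⟨ht.1.le, ht.2.le⟩⟩
        simpa using (mul_pos ht.1 hx0).le
    have hg : Tendsto (fun t : ℝ => g (t • x) x) (𝓝[Ioo 0 1] 0) (𝓝 (g 0 x)) :=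
      ((ContinuousLinearMap.apply ℝ ℝ x).continuous.tendsto (g 0)).comp
        ((hgcont 0 ⟨by simp, mem_ball_self one_pos⟩).tendsto.comp hray)
    have hconst : Tendsto (fun t : ℝ => g (t • x) x) (𝓝[Ioo 0 1] 0) (𝓝 (v x)) := by
      refine tendsto_const_nhds.congr' ?_
      filter_upwards [self_mem_nhdsWithin] with t ht
      exact (euler x ⟨hx0, hx1⟩ t ht).symm
    have : (𝓝[Ioo (0 : ℝ) 1] 0).NeBot := by
      rw [nhdsWithin_Ioo_eq_nhdsGT one_pos]
      infer_instance
    exact tendsto_nhds_unique hconst hg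
  refine ⟨(g 0).toLinearMap, interior_eq.of_subset_closure hcont (g 0).continuous.continuousOn
    hsub ?_⟩
  rintro x ⟨hx0, hx1⟩
  have hshift : Tendsto (fun t : ℝ => x + t • EuclideanSpace.single (0 : Fin (n + 2)) (1 : ℝ))
      (𝓝[>] 0) (𝓝 x) := by
    have : Continuous fun t : ℝ => x + t • EuclideanSpace.single (0 : Fin (n + 2)) (1 : ℝ) := by
      fun_prop
    simpa using (this.tendsto 0).mono_left nhdsWithin_le_nhds
  refine mem_closure_of_tendsto hshift ?_
  filter_upwards [self_mem_nhdsWithin, hshift.eventually (isOpen_ball.mem_nhds hx1)] with t ht hb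
  refine ⟨?_, hb⟩
  simpa using add_pos_of_nonneg_of_pos hx0 ht
end

section
/- Let n ≥ 2 and let P^(1), …, P^(N) be distinct hyperplanes of ℝ^{n+1} (n-dimensional linear subspaces). There exist ε₀ ∈ (0,1) and C > 0, depending only on n, N and the planes P^(1), …, P^(N), with the following property: if Q is any hyperplane of ℝ^{n+1} such that d := sup_{x ∈ Q ∩ B̄_1} dist(x, P^(1) ∪ ⋯ ∪ P^(N)) satisfies d < ε₀, and if i ∈ {1,…,N} is an index at which min_{1≤k≤N} dist_H(Q ∩ B̄_1, P^(k) ∩ B̄_1) is attained, then dist_H(Q ∩ B̄_1, P^(i) ∩ B̄_1) ≤ C·d. -/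
open Set Metric

/-- Finitely many vectors of a real inner product space admit a common vector of the unit ball
that is quantitatively non-orthogonal to all of them. -/
theorem exists_norm_le_one_forall_le_abs_inner {F ι : Type*} [NormedAddCommGroup F]
    [InnerProductSpace ℝ F] (s : Finset ι) (w : ι → F) :
    ∃ x : F, ‖x‖ ≤ 1 ∧ ∀ k ∈ s, (1 / 4 : ℝ) ^ s.card * ‖w k‖ ≤ |inner ℝ x (w k)| := by
  classical
  induction s using Finset.induction_on with
  | empty => exact ⟨0, by simp, by simp⟩
  | insert a s ha ih =>
    obtain ⟨x, hx, hxw⟩ := ih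
    rw [Finset.card_insert_of_notMem ha]
    set c : ℝ := (1 / 4) ^ s.card
    have hc0 : 0 < c := by positivity
    have hc1 : c ≤ 1 := pow_le_one₀ (by norm_num) (by norm_num)
    obtain ⟨u, hu, huw⟩ : ∃ u : F, ‖u‖ ≤ 1 ∧ inner ℝ u (w a) = ‖w a‖ := by
      refine ⟨‖w a‖⁻¹ • w a, ?_, ?_⟩
      · rw [norm_smul, norm_inv, norm_norm]
        exact inv_mul_le_one
      · rw [real_inner_smul_left, real_inner_self_eq_norm_sq]
        by_cases h : ‖w a‖ = 0
        · simp [h]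
        · field_simp
    obtain ⟨t, ht, hta⟩ : ∃ t : ℝ, |t| = c / 2 ∧
        c / 2 * ‖w a‖ ≤ |inner ℝ x (w a) + t * ‖w a‖| := by
      rcases le_total 0 (inner ℝ x (w a)) with h | h
      · refine ⟨c / 2, abs_of_pos (by positivity), le_trans ?_ (le_abs_self _)⟩
        linarith
      · refine ⟨-(c / 2), by rw [abs_neg, abs_of_pos (by positivity)],
          le_trans ?_ (neg_le_abs _)⟩
        linarith
    have hinner (v : F) : |inner ℝ ((1 / 2 : ℝ) • (x + t • u)) v| =
        1 / 2 * |inner ℝ x v + t * inner ℝ u v| := by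
      rw [real_inner_smul_left, inner_add_left, real_inner_smul_left, abs_mul]
      norm_num
    refine ⟨(1 / 2 : ℝ) • (x + t • u), ?_, fun k hk => ?_⟩
    · have h₁ := norm_add_le x (t • u)
      have h₂ : ‖t • u‖ ≤ c / 2 := by
        rw [norm_smul, Real.norm_eq_abs, ht]
        exact mul_le_of_le_one_right (by positivity) hu
      rw [norm_smul, Real.norm_of_nonneg (by norm_num)]
      linarith
    · rw [hinner, pow_succ]
      rcases Finset.mem_insert.1 hk with rfl | hk
      · rw [huw]
        linarith
      · have h₁ := hxw k hk
        have h₂ : |t * inner ℝ u (w k)| ≤ c / 2 * ‖w k‖ := by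
          rw [abs_mul, ht]
          gcongr
          exact (abs_real_inner_le_norm _ _).trans
            (mul_le_of_le_one_left (norm_nonneg _) hu)
        have h₃ := abs_sub_abs_le_abs_add (inner ℝ x (w k)) (t * inner ℝ u (w k))
        linarith

/-- A subspace of codimension one is the orthogonal complement of a unit vector. -/
theorem Submodule.exists_unit_normal {E : Type*} [NormedAddCommGroup E] [InnerProductSpace ℝ E]
    [FiniteDimensional ℝ E] (P : Submodule ℝ E)
    (hP : Module.finrank ℝ P + 1 = Module.finrank ℝ E) :
    ∃ ν : E, ‖ν‖ = 1 ∧ ∀ x, x ∈ P ↔ inner ℝ ν x = 0 := by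
  have h1 : Module.finrank ℝ Pᗮ = 1 := by
    have := P.finrank_add_finrank_orthogonal
    omega
  obtain ⟨v, hv, hspan⟩ := finrank_eq_one_iff'.1 h1
  have hv0 : ‖(v : E)‖ ≠ 0 := by simpa using hv
  refine ⟨‖(v : E)‖⁻¹ • (v : E), by rw [norm_smul, norm_inv, norm_norm, inv_mul_cancel₀ hv0],
    fun x => ?_⟩
  rw [real_inner_smul_left, mul_eq_zero, or_iff_right (inv_ne_zero hv0)]
  refine ⟨fun hx => P.inner_left_of_mem_orthogonal hx v.2, fun hx => ?_⟩
  rw [← P.orthogonal_orthogonal, Submodule.mem_orthogonal]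
  intro u hu
  obtain ⟨c, hc⟩ := hspan ⟨u, hu⟩
  have hcu : c • (v : E) = u := congrArg Subtype.val hc
  rw [← hcu, real_inner_smul_left, hx, mul_zero]

section UnitNormals

variable {E : Type*} [NormedAddCommGroup E] [InnerProductSpace ℝ E]

theorem inner_sub_inner_smul_self {ν : E} (hν : ‖ν‖ = 1) (x : E) :
    inner ℝ ν (x - (inner ℝ ν x : ℝ) • ν) = 0 := by
  rw [inner_sub_right, real_inner_smul_right, real_inner_self_eq_norm_sq, hν]
  ring

theorem norm_sub_inner_smul_sq {ν : E} (hν : ‖ν‖ = 1) (x : E) :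
    ‖x - (inner ℝ ν x : ℝ) • ν‖ ^ 2 = ‖x‖ ^ 2 - (inner ℝ ν x : ℝ) ^ 2 := by
  rw [norm_sub_sq_real, real_inner_smul_right, norm_smul, hν, real_inner_comm, mul_one,
    Real.norm_eq_abs, sq_abs]
  ring

theorem norm_sub_inner_smul_le {ν : E} (hν : ‖ν‖ = 1) (x : E) :
    ‖x - (inner ℝ ν x : ℝ) • ν‖ ≤ ‖x‖ := by
  refine le_of_sq_le_sq ?_ (norm_nonneg _)
  rw [norm_sub_inner_smul_sq hν]
  linarith [sq_nonneg (inner ℝ ν x : ℝ)]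

/-- Points of the unit ball of a hyperplane `Q` are close to the unit ball of a hyperplane `P`,
in terms of the projection to `Q` of the normal of `P`. -/
theorem exists_mem_hyperplane_dist_le {P Q : Submodule ℝ E} {μ ν : E} (hν : ‖ν‖ = 1)
    (hQ : ∀ x, x ∈ Q ↔ inner ℝ μ x = 0) (hP : ∀ x, x ∈ P ↔ inner ℝ ν x = 0)
    {x : E} (hx : x ∈ (Q : Set E) ∩ closedBall 0 1) :
    ∃ y ∈ (P : Set E) ∩ closedBall 0 1, dist x y ≤ ‖ν - (inner ℝ μ ν : ℝ) • μ‖ := by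
  have hx1 : ‖x‖ ≤ 1 := by simpa using hx.2
  refine ⟨x - (inner ℝ ν x : ℝ) • ν, ⟨(hP _).2 (inner_sub_inner_smul_self hν x), ?_⟩, ?_⟩
  · simpa using (norm_sub_inner_smul_le hν x).trans hx1
  · have h : (inner ℝ ν x : ℝ) = inner ℝ (ν - (inner ℝ μ ν : ℝ) • μ) x := by
      rw [inner_sub_left, real_inner_smul_left, (hQ x).1 hx.1]
      ring
    rw [dist_eq_norm, sub_sub_cancel, norm_smul, hν, mul_one, Real.norm_eq_abs, h]
    exact (abs_real_inner_le_norm _ _).trans (mul_le_of_le_one_right (norm_nonneg _) hx1)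

theorem hausdorffDist_hyperplane_le {P Q : Submodule ℝ E} {μ ν : E} (hμ : ‖μ‖ = 1)
    (hν : ‖ν‖ = 1) (hQ : ∀ x, x ∈ Q ↔ inner ℝ μ x = 0) (hP : ∀ x, x ∈ P ↔ inner ℝ ν x = 0) :
    hausdorffDist ((Q : Set E) ∩ closedBall 0 1) ((P : Set E) ∩ closedBall 0 1) ≤
      ‖ν - (inner ℝ μ ν : ℝ) • μ‖ := by
  have hsymm : ‖μ - (inner ℝ ν μ : ℝ) • ν‖ = ‖ν - (inner ℝ μ ν : ℝ) • μ‖ := by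
    rw [← sq_eq_sq₀ (norm_nonneg _) (norm_nonneg _), norm_sub_inner_smul_sq hν,
      norm_sub_inner_smul_sq hμ, hμ, hν, real_inner_comm]
  refine hausdorffDist_le_of_mem_dist (norm_nonneg _)
    (fun x hx => exists_mem_hyperplane_dist_le hν hQ hP hx) (fun x hx => ?_)
  rw [← hsymm]
  exact exists_mem_hyperplane_dist_le hμ hP hQ hx

end UnitNormals

/-- Let `n ≥ 2` and let `P⁽¹⁾, …, P⁽ᴺ⁾` be distinct hyperplanes of `ℝ^{n+1}`
(`n`-dimensional linear subspaces).  There exist `ε₀ ∈ (0,1)` and `C > 0`, depending only on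
`n`, `N` and the planes, such that: if `Q` is any hyperplane of `ℝ^{n+1}` whose one-sided
deviation `d := sup_{x ∈ Q ∩ B̄₁} dist(x, P⁽¹⁾ ∪ ⋯ ∪ P⁽ᴺ⁾)` satisfies `d < ε₀`, and if `i`
attains `min_k dist_H(Q ∩ B̄₁, P⁽ᵏ⁾ ∩ B̄₁)`, then `dist_H(Q ∩ B̄₁, P⁽ⁱ⁾ ∩ B̄₁) ≤ C * d`. -/
theorem nearest_plane_hausdorff_comparison
    (n N : ℕ) (hn : 2 ≤ n) (hN : 1 ≤ N)
    (P : Fin N → Submodule ℝ (EuclideanSpace ℝ (Fin (n + 1))))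
    (hdim : ∀ k, Module.finrank ℝ (P k) = n)
    (hdistinct : Function.Injective P) :
    ∃ ε₀ ∈ Ioo (0 : ℝ) 1, ∃ C : ℝ, 0 < C ∧
      ∀ Q : Submodule ℝ (EuclideanSpace ℝ (Fin (n + 1))), Module.finrank ℝ Q = n →
        ∀ d : ℝ,
          d = ⨆ x : ((Q : Set (EuclideanSpace ℝ (Fin (n + 1)))) ∩ closedBall 0 1 :
              Set (EuclideanSpace ℝ (Fin (n + 1)))),
            infDist (x : EuclideanSpace ℝ (Fin (n + 1)))
              (⋃ k, (P k : Set (EuclideanSpace ℝ (Fin (n + 1))))) →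
          d < ε₀ →
            ∀ i : Fin N,
              (∀ k : Fin N,
                hausdorffDist ((Q : Set (EuclideanSpace ℝ (Fin (n + 1)))) ∩ closedBall 0 1)
                    ((P i : Set (EuclideanSpace ℝ (Fin (n + 1)))) ∩ closedBall 0 1) ≤
                  hausdorffDist ((Q : Set (EuclideanSpace ℝ (Fin (n + 1)))) ∩ closedBall 0 1)
                    ((P k : Set (EuclideanSpace ℝ (Fin (n + 1)))) ∩ closedBall 0 1)) →
                hausdorffDist ((Q : Set (EuclideanSpace ℝ (Fin (n + 1)))) ∩ closedBall 0 1)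
                    ((P i : Set (EuclideanSpace ℝ (Fin (n + 1)))) ∩ closedBall 0 1) ≤
                  C * d := by
  have hfin : Module.finrank ℝ (EuclideanSpace ℝ (Fin (n + 1))) = n + 1 := by simp
  choose ν hν hP using fun k => (P k).exists_unit_normal (by rw [hdim, hfin])
  refine ⟨1 / 2, by norm_num, 4 ^ N, by positivity, fun Q hQdim d hd _ i hi => ?_⟩
  obtain ⟨μ, hμ, hQ⟩ := Q.exists_unit_normal (by rw [hQdim, hfin])
  set h := hausdorffDist ((Q : Set (EuclideanSpace ℝ (Fin (n + 1)))) ∩ closedBall 0 1)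
    ((P i : Set (EuclideanSpace ℝ (Fin (n + 1)))) ∩ closedBall 0 1)
  obtain ⟨x, hx, hxw⟩ := exists_norm_le_one_forall_le_abs_inner Finset.univ
    fun k => (⟨ν k - (inner ℝ μ (ν k) : ℝ) • μ,
      (hQ _).2 (inner_sub_inner_smul_self hμ (ν k))⟩ : Q)
  have hinner (k : Fin N) : (1 / 4 : ℝ) ^ N * h ≤ |inner ℝ (ν k) (x : EuclideanSpace ℝ _)| := by
    have hproj : inner ℝ (x : EuclideanSpace ℝ (Fin (n + 1))) (ν k - (inner ℝ μ (ν k) : ℝ) • μ) =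
        inner ℝ (ν k) (x : EuclideanSpace ℝ (Fin (n + 1))) := by
      rw [inner_sub_right, real_inner_smul_right, real_inner_comm μ (x : EuclideanSpace ℝ _),
        (hQ x).1 x.2, mul_zero, sub_zero, real_inner_comm]
    have h₁ := hxw k (Finset.mem_univ k)
    rw [Finset.card_univ, Fintype.card_fin, Submodule.coe_norm, Submodule.coe_inner, hproj] at h₁
    refine le_trans ?_ h₁
    gcongr
    exact (hi k).trans (hausdorffDist_hyperplane_le hμ (hν k) hQ (hP k))
  have hzero : (0 : EuclideanSpace ℝ (Fin (n + 1))) ∈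
      ⋃ k, (P k : Set (EuclideanSpace ℝ (Fin (n + 1)))) :=
    mem_iUnion.2 ⟨⟨0, hN⟩, zero_mem _⟩
  have hinf : (1 / 4 : ℝ) ^ N * h ≤ infDist (x : EuclideanSpace ℝ (Fin (n + 1)))
      (⋃ k, (P k : Set (EuclideanSpace ℝ (Fin (n + 1))))) := by
    refine (le_infDist ⟨0, hzero⟩).2 fun {y} hy => ?_
    obtain ⟨k, hk⟩ := mem_iUnion.1 hy
    have hdiff : inner ℝ (ν k) (x : EuclideanSpace ℝ _) = inner ℝ (ν k) (x - y) := by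
      rw [inner_sub_right, (hP k y).1 hk, sub_zero]
    refine (hinner k).trans ?_
    rw [hdiff, dist_eq_norm]
    simpa [hν k] using abs_real_inner_le_norm (ν k) (x - y)
  have hsup : (1 / 4 : ℝ) ^ N * h ≤ d := by
    have hbdd : BddAbove (range fun z : ((Q : Set (EuclideanSpace ℝ (Fin (n + 1)))) ∩
        closedBall 0 1 : Set (EuclideanSpace ℝ (Fin (n + 1)))) =>
          infDist (z : EuclideanSpace ℝ (Fin (n + 1)))
            (⋃ k, (P k : Set (EuclideanSpace ℝ (Fin (n + 1)))))) := by
      refine ⟨1, ?_⟩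
      rintro _ ⟨⟨y, hy⟩, rfl⟩
      exact (infDist_le_dist_of_mem hzero).trans (mem_closedBall.1 hy.2)
    have hxball : (x : EuclideanSpace ℝ (Fin (n + 1))) ∈ closedBall 0 1 := by simpa using hx
    rw [hd]
    exact hinf.trans (le_ciSup hbdd ⟨x, x.2, hxball⟩)
  calc h = 4 ^ N * ((1 / 4 : ℝ) ^ N * h) := by
        rw [← mul_assoc, ← mul_pow]
        norm_num
    _ ≤ 4 ^ N * d := by gcongr
end
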